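/- arXiv:1312.7204 — 2 statements merged into one kernel-verified Lean document; each statement's English description precedes it below -/
import Mathlib

section
/- Let K be a number field of degree d with regulator R, and let M be a positive real number. Let γ be a nonzero element of the ring of integers ℤ_K whose norm has absolute value at most M. Then there exists a unit η ∈ ℤ_K^× such that the house of ηγ (the maximum of the absolute values of all conjugates of ηγ) is bounded by an effectively computable constant depending only on d, R and M. -/
open NumberField

section

open Module MeasureTheory Metric

/-- The distance to an additive subgroup is invariant under translation by its elements. -/
lemma Submodule.infDist_add_right {E : Type*} [SeminormedAddCommGroup E] (L : Submodule ℤ E)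
    (x : E) {a : E} (ha : a ∈ L) : infDist (x + a) (L : Set E) = infDist x L := by
  have key : ∀ y b : E, b ∈ L → infDist (y + b) (L : Set E) ≤ infDist y L := by
    intro y b hb
    refine (le_infDist ⟨0, L.zero_mem⟩).2 fun l hl ↦ ?_
    simpa using infDist_le_dist_of_mem (x := y + b) (L.add_mem hl hb)
  refine le_antisymm (key x a ha) ?_
  simpa using key (x + a) (-a) (L.neg_mem ha)

section ZLattice

variable {E : Type*} [NormedAddCommGroup E] [NormedSpace ℝ E] [FiniteDimensional ℝ E]
  [MeasurableSpace E] [BorelSpace E]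

/-- If the nonzero vectors of a lattice have norm at least `δ` and some point lies at distance at
least `N * δ` from the lattice, then `N + 1` balls of radius `δ / 2` fit in a fundamental domain. -/
theorem ZLattice.mul_measureReal_ball_le_covolume (L : Submodule ℤ E) [DiscreteTopology L]
    [IsZLattice ℝ L] (μ : Measure E) [μ.IsAddHaarMeasure] {δ : ℝ} (hδ : 0 < δ)
    (hL : ∀ v ∈ L, v ≠ 0 → δ ≤ ‖v‖) {x : E} {N : ℕ} (hx : N * δ ≤ infDist x (L : Set E)) :
    (N + 1) * μ.real (ball (0 : E) (δ / 2)) ≤ covolume L μ := by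
  have hpt : ∀ k : Fin (N + 1), ∃ p : E, infDist p (L : Set E) = k * δ := by
    intro k
    have hcont : Continuous fun t : ℝ ↦ infDist (t • x) (L : Set E) := by fun_prop
    have hk : (k : ℝ) * δ ≤ N * δ := by
      have : (k : ℕ) ≤ N := Nat.lt_succ_iff.1 k.2
      gcongr
    have hmem : (k : ℝ) * δ ∈ Set.Icc (infDist ((0 : ℝ) • x) (L : Set E))
        (infDist ((1 : ℝ) • x) (L : Set E)) := by
      rw [zero_smul, one_smul, infDist_zero_of_mem L.zero_mem]
      exact ⟨by positivity, hk.trans hx⟩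
    obtain ⟨t, -, ht⟩ := intermediate_value_Icc zero_le_one hcont.continuousOn hmem
    exact ⟨t • x, ht⟩
  choose p hp using hpt
  have hsep : ∀ i j a b y, a ∈ L → b ∈ L → dist y (p i + a) < δ / 2 → dist y (p j + b) < δ / 2 →
      i = j ∧ a = b := by
    intro i j a b y ha hb hi hj
    have hlt : dist (p i + a) (p j + b) < δ := by
      linarith [dist_triangle_left (p i + a) (p j + b) y]
    have h₁ := infDist_le_infDist_add_dist (s := (L : Set E)) (x := p i + a) (y := p j + b)
    have h₂ := infDist_le_infDist_add_dist (s := (L : Set E)) (x := p j + b) (y := p i + a)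
    rw [dist_comm] at h₂
    rw [L.infDist_add_right _ ha, L.infDist_add_right _ hb, hp, hp] at h₁ h₂
    have hij : i = j := by
      have h₃ : (i : ℝ) < j + 1 := lt_of_mul_lt_mul_right (by linarith) hδ.le
      have h₄ : (j : ℝ) < i + 1 := lt_of_mul_lt_mul_right (by linarith) hδ.le
      norm_cast at h₃ h₄
      ext
      omega
    refine ⟨hij, ?_⟩
    subst hij
    by_contra hab
    rw [dist_add_left, dist_eq_norm] at hlt
    exact hlt.not_ge (hL _ (L.sub_mem ha hb) (sub_ne_zero.2 hab))
  by_contra! hvol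
  let b := Free.chooseBasis ℤ L
  have fund := isAddFundamentalDomain b μ
  have : MeasurableVAdd L E := (inferInstance : MeasurableVAdd L.toAddSubgroup E)
  have : VAddInvariantMeasure L E μ :=
    (inferInstance : VAddInvariantMeasure L.toAddSubgroup E μ)
  let S : Set E := ⋃ i, ball (p i) (δ / 2)
  have hS : MeasurableSet S := MeasurableSet.iUnion fun i ↦ measurableSet_ball
  have hμS : μ.real S = (N + 1) * μ.real (ball (0 : E) (δ / 2)) := by
    rw [measureReal_def, measure_iUnion _ fun i ↦ measurableSet_ball]
    · simp only [Measure.addHaar_ball_center, tsum_fintype, Finset.sum_const, Finset.card_univ,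
        Fintype.card_fin, measureReal_def, nsmul_eq_mul, ENNReal.toReal_mul, ENNReal.toReal_natCast]
      push_cast
      rfl
    · intro i j hij
      refine Set.disjoint_left.2 fun y hi hj ↦ hij ?_
      exact (hsep i j 0 0 y L.zero_mem L.zero_mem (by simpa using hi) (by simpa using hj)).1
  rw [covolume_eq_measure_fundamentalDomain L μ fund, ← hμS] at hvol
  have hμ : μ (ZSpan.fundamentalDomain (b.ofZLatticeBasis ℝ L)) < μ S := by
    rw [measureReal_def, measureReal_def] at hvol
    refine (ENNReal.toReal_lt_toReal ?_ ?_).1 hvol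
    · exact (ZSpan.fundamentalDomain_isBounded _).measure_lt_top.ne
    · exact (Bornology.isBounded_iUnion.2 fun i ↦ isBounded_ball).measure_lt_top.ne
  obtain ⟨a, c, hac, hdisj⟩ := exists_pair_mem_lattice_not_disjoint_vadd fund hS.nullMeasurableSet hμ
  obtain ⟨y, ⟨u, hu, rfl⟩, v, hv, huv⟩ := Set.not_disjoint_iff.1 hdisj
  simp only [S, Set.mem_iUnion, mem_ball] at hu hv
  obtain ⟨i, hi⟩ := hu
  obtain ⟨j, hj⟩ := hv
  refine hac (Subtype.ext (hsep i j a c (u + a) a.2 c.2 (by simpa using hi) ?_).2)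
  have : u + a = v + c := by
    have h : (c : E) + v = a + u := huv
    rw [add_comm u, ← h, add_comm]
  simpa [this] using hj

end ZLattice

namespace NumberField

/-- Up to embedding in `ℂ`, there are finitely many algebraic integers of bounded degree and
house. -/
theorem exists_finite_forall_embedding_mem.{u} (d : ℕ) (B : ℝ) :
    ∃ S : Set ℂ, S.Finite ∧ ∀ (K : Type u) [Field K] [NumberField K] (x : K),
      finrank ℚ K = d → IsIntegral ℤ x → (∀ φ : K →+* ℂ, ‖φ x‖ ≤ B) → ∀ φ : K →+* ℂ, φ x ∈ S := by
  classical
  let C := Nat.ceil (max B 1 ^ d * d.choose (d / 2))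
  refine ⟨_, Polynomial.bUnion_roots_finite (algebraMap ℤ ℂ) d (Set.finite_Icc (-C : ℤ) C), ?_⟩
  rintro K _ _ x rfl hx hB φ
  simp_rw [Set.mem_iUnion]
  have h_map_ℚ_minpoly := minpoly.isIntegrallyClosed_eq_field_fractions' ℚ hx
  refine ⟨minpoly ℤ x, ⟨?_, fun i => ?_⟩,
    Polynomial.mem_rootSet.2 ⟨minpoly.ne_zero hx, ?_⟩⟩
  · rw [← (minpoly.monic hx).natDegree_map (algebraMap ℤ ℚ), ← h_map_ℚ_minpoly]
    exact minpoly.natDegree_le x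
  · rw [Set.mem_Icc, ← abs_le, ← @Int.cast_le ℝ]
    refine (Eq.trans_le ?_ <| Embeddings.coeff_bdd_of_norm_le hB i).trans (Nat.le_ceil _)
    rw [h_map_ℚ_minpoly, Polynomial.coeff_map, eq_intCast, Int.norm_cast_rat, Int.norm_eq_abs,
      Int.cast_abs]
  · have := Polynomial.aeval_algHom_apply φ.toIntAlgHom x (minpoly ℤ x)
    simpa using this

open NumberField.Units dirichletUnitTheorem

lemma card_infinitePlace_le_finrank (K : Type*) [Field K] [NumberField K] :
    Fintype.card (InfinitePlace K) ≤ finrank ℚ K := by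
  rw [← InfinitePlace.sum_mult_eq, Fintype.card_eq_sum_ones]
  exact Finset.sum_le_sum fun w _ ↦ InfinitePlace.mult_pos

open scoped Classical in
/-- The logarithmic embeddings of non-torsion units are bounded away from zero in terms of the
degree only. -/
theorem exists_pos_le_norm_logEmbedding.{u} (d : ℕ) :
    ∃ δ : ℝ, 0 < δ ∧ δ ≤ 1 ∧ ∀ (K : Type u) [Field K] [NumberField K] (u : (𝓞 K)ˣ),
      finrank ℚ K = d → logEmbedding K (Additive.ofMul u) ≠ 0 →
        δ ≤ ‖logEmbedding K (Additive.ofMul u)‖ := by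
  obtain ⟨S, hS, hmem⟩ := exists_finite_forall_embedding_mem d (Real.exp 1)
  let n : ℕ := S.ncard
  refine ⟨1 / (d * n + 1), by positivity, div_le_one_of_le₀ (by simp; positivity) (by positivity),
    fun K _ _ u hd hu ↦ ?_⟩
  by_contra! hlt
  apply hu
  set r := ‖logEmbedding K (Additive.ofMul u)‖ with hr
  have hcard : (Fintype.card (InfinitePlace K) : ℝ) ≤ d := by
    exact_mod_cast hd ▸ card_infinitePlace_le_finrank K
  have hpow : ∀ k ≤ n, ∀ φ : K →+* ℂ, ‖φ ((u : K) ^ k)‖ ≤ Real.exp 1 := by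
    intro k hk
    refine (InfinitePlace.le_iff_le _ _).1 fun w ↦ ?_
    have hw := (le_abs_self _).trans (log_le_of_logEmbedding_le (norm_nonneg _) hr.symm.ge w)
    rw [map_pow, ← Real.log_le_iff_le_exp (pow_pos (pos_at_place u w) k), Real.log_pow]
    calc k * Real.log (w u) ≤ n * (d * r) := by
          have : Real.log (w u) ≤ d * r := hw.trans (by gcongr)
          have h0 : 0 ≤ d * r := by positivity
          exact (mul_le_mul_of_nonneg_left this (Nat.cast_nonneg k)).trans (by gcongr)
      _ ≤ 1 := by
          rw [lt_div_iff₀ (by positivity)] at hlt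
          nlinarith [norm_nonneg (logEmbedding K (Additive.ofMul u))]
  let φ : K →+* ℂ := Classical.arbitrary _
  obtain ⟨i, hi, j, hj, hij, heq⟩ := Set.exists_ne_map_eq_of_ncard_lt_of_maps_to
    (s := (Finset.range (n + 1) : Set ℕ)) (t := S) (by simp [n]) (f := fun k ↦ φ ((u : K) ^ k))
    (fun k hk ↦ hmem K _ hd (((u : 𝓞 K).isIntegral_coe).pow k)
      (hpow k (by simpa [Nat.lt_succ_iff] using hk)) φ) hS
  have heq' : u ^ i = u ^ j := by
    have := φ.injective heq
    ext
    simpa using this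
  rw [logEmbedding_eq_zero_iff]
  change IsOfFinOrder u
  by_contra hfin
  exact hij (injective_pow_iff_not_isOfFinOrder.2 hfin heq')

open scoped Classical in
/-- A quantitative form of Dirichlet's unit theorem: the unit lattice is dense at a scale which
depends only on the degree and the regulator. -/
theorem exists_forall_exists_norm_sub_logEmbedding_le.{u} :
    ∃ D : ℕ → ℝ → ℝ, ∀ (K : Type u) [Field K] [NumberField K] (x : logSpace K),
      ∃ u : (𝓞 K)ˣ, ‖x - logEmbedding K (Additive.ofMul u)‖ ≤ D (finrank ℚ K) (regulator K) := by
  classical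
  choose δ hδ hδ1 hlog using exists_pos_le_norm_logEmbedding
  refine ⟨fun d R ↦ R / δ d ^ d + 1, fun K _ _ x ↦ ?_⟩
  set d := finrank ℚ K with hd
  have hR : 0 < regulator K := regulator_pos K
  suffices h : infDist x (unitLattice K : Set (logSpace K)) ≤ regulator K / δ d ^ d by
    obtain ⟨_, ⟨u, -, rfl⟩, hu⟩ := (infDist_lt_iff ⟨0, (unitLattice K).zero_mem⟩).1
      (h.trans_lt (lt_add_one _))
    exact ⟨u.toMul, by simpa [dist_eq_norm] using hu.le⟩
  by_contra! hlt
  set N := ⌊regulator K / δ d ^ d / δ d⌋₊ with hN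
  have hNδ : N * δ d ≤ infDist x (unitLattice K : Set (logSpace K)) := by
    rw [← le_div_iff₀ (hδ d)]
    exact (Nat.floor_le (by have := hδ d; positivity)).trans
      (by have := hδ d; gcongr)
  have hmin : ∀ v ∈ unitLattice K, v ≠ 0 → δ d ≤ ‖v‖ := by
    rintro _ ⟨u, -, rfl⟩ hu
    exact hlog d K u.toMul hd.symm hu
  have hvol := ZLattice.mul_measureReal_ball_le_covolume (unitLattice K) volume (hδ d) hmin hNδ
  have hball : volume.real (ball (0 : logSpace K) (δ d / 2)) = δ d ^ rank K := by
    rw [measureReal_def, Real.volume_pi_ball _ (half_pos (hδ d)), mul_div_cancel₀ _ two_ne_zero,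
      ENNReal.toReal_ofReal (pow_nonneg (hδ d).le _), ← Fintype.card_congr (equivFinRank K),
      Fintype.card_fin]
  have hrank : rank K ≤ d := (Nat.sub_le _ _).trans (card_infinitePlace_le_finrank K)
  have hN1 : regulator K / δ d ^ d < N + 1 :=
    (le_div_self (by have := hδ d; positivity) (hδ d) (hδ1 d)).trans_lt (Nat.lt_floor_add_one _)
  rw [hball] at hvol
  have : regulator K < (N + 1) * δ d ^ rank K := by
    rw [div_lt_iff₀ (pow_pos (hδ d) _)] at hN1
    exact hN1.trans_le (by gcongr ?_ * ?_; exact pow_le_pow_of_le_one (hδ d).le (hδ1 d) hrank)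
  exact this.not_ge hvol

/-- A nonzero element whose components away from `w₀` have bounded logarithm is controlled at
every place by its norm. -/
theorem log_place_le_of_forall_ne {K : Type*} [Field K] [NumberField K] {x : K} (hx : x ≠ 0)
    {r : ℝ} (hr : 0 ≤ r) (h : ∀ w : InfinitePlace K, w ≠ w₀ → |w.mult * Real.log (w x)| ≤ r)
    (w : InfinitePlace K) :
    Real.log (w x) ≤
      |Real.log ((|Algebra.norm ℚ x| : ℚ) : ℝ)| + Fintype.card (InfinitePlace K) * r := by
  classical
  have hpos : ∀ v : InfinitePlace K, 0 < v x := fun v ↦ InfinitePlace.pos_iff.2 hx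
  have hsum : ∑ v : InfinitePlace K, v.mult * Real.log (v x) =
      Real.log ((|Algebra.norm ℚ x| : ℚ) : ℝ) := by
    rw [← InfinitePlace.prod_eq_abs_norm, Real.log_prod fun v _ ↦ (pow_pos (hpos v) _).ne']
    simp_rw [Real.log_pow]
  have hmult : (1 : ℝ) ≤ w.mult := by exact_mod_cast InfinitePlace.mult_pos
  have hcard : (1 : ℝ) ≤ Fintype.card (InfinitePlace K) := by
    exact_mod_cast Fintype.card_pos
  rcases le_or_gt (Real.log (w x)) 0 with hneg | hlog
  · exact hneg.trans (by positivity)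
  refine (le_mul_of_one_le_left hlog.le hmult).trans ?_
  by_cases hw : w = w₀
  · rw [← Finset.add_sum_erase _ _ (Finset.mem_univ w)] at hsum
    have hrest : |∑ v ∈ Finset.univ.erase w, v.mult * Real.log (v x)| ≤
        Fintype.card (InfinitePlace K) * r := by
      refine (Finset.abs_sum_le_sum_abs _ _).trans ?_
      refine (Finset.sum_le_card_nsmul _ _ r fun v hv ↦
        h v (hw ▸ Finset.ne_of_mem_erase hv)).trans ?_
      rw [nsmul_eq_mul]
      gcongr
      exact Finset.card_le_univ _
    linarith [neg_abs_le (∑ v ∈ Finset.univ.erase w, v.mult * Real.log (v x)),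
      le_abs_self (Real.log ((|Algebra.norm ℚ x| : ℚ) : ℝ))]
  · have := (le_abs_self _).trans (h w hw)
    nlinarith [abs_nonneg (Real.log ((|Algebra.norm ℚ x| : ℚ) : ℝ))]

end NumberField

end

/-- Let `K` be a number field of degree `d` with regulator `R`, and `M > 0`. For every
nonzero `γ ∈ ℤ_K` whose norm has absolute value at most `M`, there exists a unit
`η ∈ ℤ_K^×` such that the house of `ηγ` is bounded by an (effectively computable)
constant depending only on `d`, `R` and `M`. -/
theorem exists_unit_house_le_of_norm_le :
    ∃ C : ℕ → ℝ → ℝ → ℝ,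
      ∀ (K : Type) [Field K] [NumberField K] (M : ℝ) (γ : 𝓞 K),
        0 < M → γ ≠ 0 →
        ((|Algebra.norm ℚ (algebraMap (𝓞 K) K γ)| : ℚ) : ℝ) ≤ M →
        ∃ η : (𝓞 K)ˣ,
          house (algebraMap (𝓞 K) K (↑η * γ)) ≤
            C (Module.finrank ℚ K) (Units.regulator K) M := by
  classical
  obtain ⟨D, hD⟩ := exists_forall_exists_norm_sub_logEmbedding_le
  refine ⟨fun d R M ↦ Real.exp (|Real.log M| + d * |D d R|), fun K _ _ M γ hM hγ hnorm ↦ ?_⟩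
  obtain ⟨u, hu⟩ := hD K fun w ↦ w.1.mult * Real.log (w.1 (γ : K))
  refine ⟨u⁻¹, ?_⟩
  set x : K := algebraMap (𝓞 K) K (↑u⁻¹ * γ) with hxdef
  have hx : x ≠ 0 := RingOfIntegers.coe_ne_zero_iff.2 (mul_ne_zero u⁻¹.ne_zero hγ)
  have hxγ : (u : K) * x = γ := by
    rw [hxdef, ← map_mul, Units.mul_inv_cancel_left]
  have hlog (w : InfinitePlace K) :
      Real.log (w x) = Real.log (w (γ : K)) - Real.log (w (u : K)) := by
    rw [← hxγ, map_mul, Real.log_mul (Units.pos_at_place u w).ne' (InfinitePlace.pos_iff.2 hx).ne',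
      add_sub_cancel_left]
  have hnormx : |Algebra.norm ℚ x| = |Algebra.norm ℚ (γ : K)| := by
    rw [← hxγ, map_mul, abs_mul, NumberField.Units.norm, one_mul]
  have hone : (1 : ℝ) ≤ ((|Algebra.norm ℚ (γ : K)| : ℚ) : ℝ) := by
    rw [← Algebra.coe_norm_int]
    exact_mod_cast Int.one_le_abs (Algebra.norm_ne_zero_iff.2 hγ)
  have hcomp : ∀ w : InfinitePlace K, w ≠ Units.dirichletUnitTheorem.w₀ →
      |w.mult * Real.log (w x)| ≤ |D (Module.finrank ℚ K) (Units.regulator K)| := by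
    intro w hw
    rw [hlog, mul_sub]
    exact ((norm_le_pi_norm _ ⟨w, hw⟩).trans hu).trans (le_abs_self _)
  have hplace := log_place_le_of_forall_ne hx (abs_nonneg _) hcomp
  refine (pi_norm_le_iff_of_nonneg (Real.exp_pos _).le).2 ?_
  refine (InfinitePlace.le_iff_le x _).1 fun w ↦ ?_
  rw [← Real.log_le_iff_le_exp (InfinitePlace.pos_iff.2 hx)]
  refine (hplace w).trans ?_
  rw [hnormx, abs_of_nonneg (Real.log_nonneg hone), abs_of_nonneg
    (Real.log_nonneg (hone.trans hnorm))]
  gcongr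
  exact card_infinitePlace_le_finrank K
end

section
/- Let δ₁ and δ₂ be real numbers in the interval [0, 2π) such that e^{iδ₁} and e^{iδ₂} are algebraic numbers. Then there exists an explicit constant c₂ > 0, depending only on δ₁ and δ₂, such that for every n ∈ ℤ with δ₁ + nδ₂ ∉ ℤπ, one has |sin(δ₁ + nδ₂)| ≥ (|n| + 2)^{−c₂}. -/
open Real

/-- Liouville's inequality in a number field. -/
lemma NumberField.exists_liouville_bound {K : Type*} [Field K] [NumberField K] (φ : K →ₐ[ℚ] ℂ)
    (α β : K) :
    ∃ c : ℝ, 1 ≤ c ∧ ∀ {ι : Type} (s : Finset ι) (a : ι → ℤ) (e f : ι → ℕ) (D : ℕ) (x : ℝ),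
      0 ≤ x → (∀ i ∈ s, e i ≤ D) → (∀ i ∈ s, f i ≤ D) → (∑ i ∈ s, |(a i : ℝ)|) ≤ Real.exp x →
      ∑ i ∈ s, (a i : K) * α ^ e i * β ^ f i ≠ 0 →
      Real.exp (-(c * (D + x))) ≤ ‖φ (∑ i ∈ s, (a i : K) * α ^ e i * β ^ f i)‖ := by
  classical
  have hαa : IsAlgebraic ℤ α := (IsFractionRing.isAlgebraic_iff ℤ ℚ K).2
    (Algebra.IsAlgebraic.isAlgebraic α)
  have hβa : IsAlgebraic ℤ β := (IsFractionRing.isAlgebraic_iff ℤ ℚ K).2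
    (Algebra.IsAlgebraic.isAlgebraic β)
  obtain ⟨u, hu, hu'⟩ := hαa.exists_integral_multiple
  obtain ⟨v, hv, hv'⟩ := hβa.exists_integral_multiple
  obtain ⟨A, hA1, hA⟩ : ∃ A : ℝ, 1 ≤ A ∧ ∀ σ : K →ₐ[ℚ] ℂ, ‖σ α‖ ≤ A ∧ ‖σ β‖ ≤ A := by
    refine ⟨1 + ∑ σ : K →ₐ[ℚ] ℂ, (‖σ α‖ + ‖σ β‖), ?_, fun σ => ?_⟩
    · have : 0 ≤ ∑ σ : K →ₐ[ℚ] ℂ, (‖σ α‖ + ‖σ β‖) := Finset.sum_nonneg fun σ _ => by positivity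
      linarith
    · have := Finset.single_le_sum (f := fun σ : K →ₐ[ℚ] ℂ => ‖σ α‖ + ‖σ β‖)
        (fun σ _ => by positivity) (Finset.mem_univ σ)
      have h1 := norm_nonneg (σ α)
      have h2 := norm_nonneg (σ β)
      constructor <;> linarith
  set U : ℝ := |(u : ℝ)| * |(v : ℝ)| with hU
  have hU1 : 1 ≤ U := by
    have h1 : (1 : ℝ) ≤ |(u : ℝ)| := by exact_mod_cast Int.one_le_abs hu
    have h2 : (1 : ℝ) ≤ |(v : ℝ)| := by exact_mod_cast Int.one_le_abs hv
    exact one_le_mul_of_one_le_of_one_le h1 h2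
  set d : ℕ := Fintype.card (K →ₐ[ℚ] ℂ) with hd
  set k : ℝ := Real.log (U * A ^ 2) with hk
  have hUA : 1 ≤ U * A ^ 2 := one_le_mul_of_one_le_of_one_le hU1 (one_le_pow₀ hA1)
  have hk0 : 0 ≤ k := Real.log_nonneg hUA
  have hek : Real.exp k = U * A ^ 2 := Real.exp_log (by positivity)
  refine ⟨1 + (d + 1) * (k + 1), ?_, ?_⟩
  · have : 0 ≤ ((d : ℝ) + 1) * (k + 1) := by positivity
    linarith
  intro ι s a e f D x hx he hf hsum hne
  set ξ := ∑ i ∈ s, (a i : K) * α ^ e i * β ^ f i with hξ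
  set η : K := (u : K) ^ D * (v : K) ^ D * ξ with hη
  have hηint : IsIntegral ℤ η := by
    have : η = ∑ i ∈ s, (a i : K) * ((u : K) ^ (D - e i) * (u * α) ^ e i) *
        ((v : K) ^ (D - f i) * (v * β) ^ f i) := by
      rw [hη, hξ, Finset.mul_sum]
      refine Finset.sum_congr rfl fun i hi => ?_
      rw [← pow_sub_mul_pow (u : K) (he i hi), ← pow_sub_mul_pow (v : K) (hf i hi)]
      ring
    rw [this]
    simp only [zsmul_eq_mul] at hu' hv'
    refine IsIntegral.sum _ fun i _ => ?_
    have h1 : ∀ z : ℤ, IsIntegral ℤ (z : K) := fun z => by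
      simpa using (isIntegral_algebraMap (R := ℤ) (A := K) (x := z))
    exact ((h1 _).mul (((h1 _).pow _).mul (hu'.pow _))).mul (((h1 _).pow _).mul (hv'.pow _))
  have hη0 : η ≠ 0 := by
    refine mul_ne_zero (mul_ne_zero (pow_ne_zero _ ?_) (pow_ne_zero _ ?_)) hne
    · exact_mod_cast hu
    · exact_mod_cast hv
  have hnorm : (1 : ℝ) ≤ ∏ σ : K →ₐ[ℚ] ℂ, ‖σ η‖ := by
    have h1 : IsIntegral ℤ (Algebra.norm ℚ η) := Algebra.isIntegral_norm ℚ hηint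
    obtain ⟨z, hz⟩ := IsIntegrallyClosed.isIntegral_iff.1 h1
    have hz0 : z ≠ 0 := by
      rintro rfl
      rw [map_zero] at hz
      exact hη0 (Algebra.norm_eq_zero_iff.1 hz.symm)
    have h2 := Algebra.norm_eq_prod_embeddings ℚ ℂ η
    rw [← norm_prod, ← h2, ← hz]
    simp only [algebraMap_int_eq, eq_intCast, map_intCast, Complex.norm_intCast]
    exact_mod_cast Int.one_le_abs hz0
  have hbd : ∀ σ : K →ₐ[ℚ] ℂ, ‖σ ξ‖ ≤ A ^ (2 * D) * Real.exp x := by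
    intro σ
    rw [hξ, map_sum]
    calc ‖∑ i ∈ s, σ ((a i : K) * α ^ e i * β ^ f i)‖
        ≤ ∑ i ∈ s, ‖σ ((a i : K) * α ^ e i * β ^ f i)‖ := norm_sum_le _ _
      _ ≤ ∑ i ∈ s, |(a i : ℝ)| * A ^ (2 * D) := by
          refine Finset.sum_le_sum fun i hi => ?_
          simp only [map_mul, map_pow, map_intCast, norm_mul, norm_pow, Complex.norm_intCast]
          rw [two_mul, pow_add, mul_assoc]
          gcongr ?_ * (?_ * ?_)
          · exact (pow_le_pow_left₀ (norm_nonneg _) (hA σ).1 _).trans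
              (pow_le_pow_right₀ hA1 (he i hi))
          · exact (pow_le_pow_left₀ (norm_nonneg _) (hA σ).2 _).trans
              (pow_le_pow_right₀ hA1 (hf i hi))
      _ ≤ A ^ (2 * D) * Real.exp x := by
          rw [← Finset.sum_mul, mul_comm]; gcongr
  set Y : ℝ := U ^ D * (A ^ (2 * D) * Real.exp x) with hY
  have hση : ∀ σ : K →ₐ[ℚ] ℂ, ‖σ η‖ = U ^ D * ‖σ ξ‖ := by
    intro σ
    simp only [hη, map_mul, map_pow, map_intCast, norm_mul, norm_pow, Complex.norm_intCast, hU,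
      mul_pow]
  have hYe : Y = Real.exp (D * k + x) := by
    rw [Real.exp_add, mul_comm (D : ℝ), Real.exp_mul, hek, Real.rpow_natCast, hY, mul_pow, pow_mul]
    ring
  have hY1 : 1 ≤ Y := by
    rw [hYe]; apply Real.one_le_exp; positivity
  have hle : 1 ≤ (U ^ D * ‖φ ξ‖) * Y ^ d := by
    refine hnorm.trans ?_
    rw [← Finset.mul_prod_erase _ _ (Finset.mem_univ φ), hση]
    gcongr ?_ * ?_
    calc ∏ σ ∈ Finset.univ.erase φ, ‖σ η‖ ≤ ∏ σ ∈ Finset.univ.erase φ, Y := by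
          refine Finset.prod_le_prod (fun _ _ => norm_nonneg _) fun σ _ => ?_
          rw [hση, hY]
          gcongr
          exact hbd σ
      _ = Y ^ (Finset.univ.erase φ).card := by rw [Finset.prod_const]
      _ ≤ Y ^ d := pow_le_pow_right₀ hY1 (Finset.card_le_univ _)
  have hUk : U ^ D ≤ Real.exp (D * k) := by
    rw [mul_comm (D : ℝ), Real.exp_mul, hek, Real.rpow_natCast]
    gcongr
    exact le_mul_of_one_le_right (by positivity) (one_le_pow₀ hA1)
  have h3 : 1 ≤ ‖φ ξ‖ * Real.exp (D * k + d * (D * k + x)) := by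
    refine hle.trans ?_
    rw [hYe, ← Real.exp_nat_mul, Real.exp_add, mul_comm (U ^ D), mul_assoc]
    gcongr
  have h4 : Real.exp (-(D * k + d * (D * k + x))) ≤ ‖φ ξ‖ := by
    rw [Real.exp_neg, inv_le_iff_one_le_mul₀ (Real.exp_pos _)]
    exact h3
  refine le_trans (Real.exp_le_exp.2 ?_) h4
  have hD : (0 : ℝ) ≤ D := by positivity
  have hd0 : (0 : ℝ) ≤ d := by positivity
  nlinarith [mul_nonneg hD hk0, mul_nonneg hd0 hD, mul_nonneg hd0 hx, mul_nonneg hx hk0,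
    mul_nonneg (mul_nonneg hd0 hx) hk0]

/-- Liouville's inequality for integer polynomials in two algebraic complex numbers. -/
lemma exists_liouville_bound {α β : ℂ} (hα : IsAlgebraic ℚ α) (hβ : IsAlgebraic ℚ β) :
    ∃ c : ℝ, 1 ≤ c ∧ ∀ {ι : Type} (s : Finset ι) (a : ι → ℤ) (e f : ι → ℕ) (D : ℕ) (x : ℝ),
      0 ≤ x → (∀ i ∈ s, e i ≤ D) → (∀ i ∈ s, f i ≤ D) → (∑ i ∈ s, |(a i : ℝ)|) ≤ Real.exp x →
      ∑ i ∈ s, (a i : ℂ) * α ^ e i * β ^ f i ≠ 0 →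
      Real.exp (-(c * (D + x))) ≤ ‖∑ i ∈ s, (a i : ℂ) * α ^ e i * β ^ f i‖ := by
  let K := IntermediateField.adjoin ℚ ({α, β} : Set ℂ)
  have hfin : FiniteDimensional ℚ K := by
    refine IntermediateField.finiteDimensional_adjoin fun x hx => ?_
    rcases hx with rfl | rfl
    · exact hα.isIntegral
    · exact hβ.isIntegral
  have : NumberField K := ⟨⟩
  have hαK : α ∈ K := IntermediateField.subset_adjoin _ _ (by simp)
  have hβK : β ∈ K := IntermediateField.subset_adjoin _ _ (by simp)
  obtain ⟨c, hc, h⟩ := NumberField.exists_liouville_bound K.val ⟨α, hαK⟩ ⟨β, hβK⟩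
  refine ⟨c, hc, fun s a e f D x hx he hf hs hne => ?_⟩
  have key := h s a e f D x hx he hf hs
  have hv : K.val (∑ i ∈ s, (a i : K) * (⟨α, hαK⟩ : K) ^ e i * (⟨β, hβK⟩ : K) ^ f i) =
      ∑ i ∈ s, (a i : ℂ) * α ^ e i * β ^ f i := by
    simp [map_sum]
  rw [← hv]
  refine key fun h0 => hne ?_
  rw [← hv, h0, map_zero]

lemma Differentiable.exists_eq_pow_mul {F : ℂ → ℂ} (hF : Differentiable ℂ F) {a : ℂ} {T : ℕ}
    (h : (T : ℕ∞) ≤ analyticOrderAt F a) :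
    ∃ Q : ℂ → ℂ, Differentiable ℂ Q ∧ ∀ z, F z = (z - a) ^ T * Q z := by
  induction T generalizing F with
  | zero => exact ⟨F, hF, by simp⟩
  | succ T ih =>
    have hFa : F a = 0 := by
      rw [← AnalyticAt.analyticOrderAt_ne_zero (hF.analyticAt a)]
      intro h0
      rw [h0] at h
      simp at h
    have hd : Differentiable ℂ (dslope F a) := by
      rw [← differentiableOn_univ]
      exact (Complex.differentiableOn_dslope Filter.univ_mem).2 hF.differentiableOn
    have hmul : F = (fun z => z - a) * dslope F a := by
      funext z
      have := sub_smul_dslope F a z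
      simpa [hFa] using this.symm
    have hord : analyticOrderAt (fun z : ℂ => z - a) a = 1 :=
      AnalyticAt.analyticOrderAt_eq_one_of_zero_deriv_ne_zero (by fun_prop) (by simp) (by simp)
    have h2 : (T : ℕ∞) ≤ analyticOrderAt (dslope F a) a := by
      rw [hmul, analyticOrderAt_mul (by fun_prop) (hd.analyticAt a), hord] at h
      push_cast at h
      rw [add_comm] at h
      exact (ENat.add_le_add_iff_left (by simp)).1 h
    obtain ⟨Q, hQ, hQ'⟩ := ih hd h2
    refine ⟨Q, hQ, fun z => ?_⟩
    rw [hmul, Pi.mul_apply, hQ' z]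
    ring

lemma Differentiable.exists_eq_prod_pow_mul {F : ℂ → ℂ} (hF : Differentiable ℂ F)
    (s : Finset ℂ) {T : ℕ} (h : ∀ a ∈ s, (T : ℕ∞) ≤ analyticOrderAt F a) :
    ∃ Q : ℂ → ℂ, Differentiable ℂ Q ∧ ∀ z, F z = (∏ a ∈ s, (z - a) ^ T) * Q z := by
  classical
  induction s using Finset.induction_on with
  | empty => exact ⟨F, hF, by simp⟩
  | insert b s hb ih =>
    obtain ⟨Q, hQ, hQ'⟩ := ih fun a ha => h a (Finset.mem_insert_of_mem ha)
    have hP : AnalyticAt ℂ (fun z => ∏ a ∈ s, (z - a) ^ T) b := by fun_prop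
    have hP0 : analyticOrderAt (fun z => ∏ a ∈ s, (z - a) ^ T) b = 0 := by
      rw [hP.analyticOrderAt_eq_zero, Finset.prod_ne_zero_iff]
      exact fun a ha => pow_ne_zero _ (sub_ne_zero.2 fun hab => hb (hab ▸ ha))
    have hb' := h b (Finset.mem_insert_self _ _)
    rw [show F = (fun z => ∏ a ∈ s, (z - a) ^ T) * Q from funext hQ',
      analyticOrderAt_mul hP (hQ.analyticAt b), hP0, zero_add] at hb'
    obtain ⟨Q₂, hQ₂, hQ₂'⟩ := hQ.exists_eq_pow_mul hb'
    refine ⟨Q₂, hQ₂, fun z => ?_⟩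
    rw [hQ', hQ₂', Finset.prod_insert hb]
    ring

/-- A Schwarz lemma for an entire function with zeros of order at least `T` at `1, …, R`. -/
lemma norm_le_of_le_analyticOrderAt {F : ℂ → ℂ} (hF : Differentiable ℂ F) {T R : ℕ} {ρ G : ℝ}
    (hρ : 0 < ρ) (hR : (R : ℝ) ≤ ρ)
    (hord : ∀ r ∈ Finset.Icc 1 R, (T : ℕ∞) ≤ analyticOrderAt F (r : ℂ))
    (hG : ∀ z : ℂ, ‖z‖ ≤ 8 * ρ → ‖F z‖ ≤ G) {z : ℂ} (hz : ‖z‖ ≤ ρ) :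
    ‖F z‖ ≤ G * Real.exp (-(R * T)) := by
  classical
  have hG0 : 0 ≤ G := (norm_nonneg _).trans (hG z (by linarith))
  set s : Finset ℂ := (Finset.Icc 1 R).image (fun r : ℕ => (r : ℂ)) with hs
  have hcard : s.card = R := by
    rw [hs, Finset.card_image_of_injective _ Nat.cast_injective]; simp
  have hmem : ∀ a ∈ s, ‖a‖ ≤ ρ := by
    intro a ha
    simp only [hs, Finset.mem_image, Finset.mem_Icc] at ha
    obtain ⟨r, hr, rfl⟩ := ha
    rw [Complex.norm_natCast]
    exact le_trans (by exact_mod_cast hr.2) hR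
  obtain ⟨Q, hQ, hQ'⟩ := hF.exists_eq_prod_pow_mul s (T := T) (by
    intro a ha
    simp only [hs, Finset.mem_image] at ha
    obtain ⟨r, hr, rfl⟩ := ha
    exact hord r hr)
  have hQb : ‖Q z‖ ≤ G / (7 * ρ) ^ (T * R) := by
    refine Complex.norm_le_of_forall_mem_frontier_norm_le (U := Metric.ball 0 (8 * ρ))
      Metric.isBounded_ball hQ.diffContOnCl (fun w hw => ?_) ?_
    · rw [frontier_ball _ (by positivity), mem_sphere_zero_iff_norm] at hw
      have h1 : (7 * ρ) ^ (T * R) ≤ ‖∏ a ∈ s, (w - a) ^ T‖ := by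
        rw [norm_prod, pow_mul]
        rw [← hcard, ← Finset.prod_const]
        refine Finset.prod_le_prod (fun _ _ => by positivity) fun a ha => ?_
        rw [norm_pow]
        gcongr
        have := norm_sub_norm_le w a
        have := hmem a ha
        linarith
      rw [le_div_iff₀ (by positivity)]
      calc ‖Q w‖ * (7 * ρ) ^ (T * R) ≤ ‖Q w‖ * ‖∏ a ∈ s, (w - a) ^ T‖ := by gcongr
        _ = ‖F w‖ := by rw [hQ', norm_mul, mul_comm]
        _ ≤ G := hG w hw.le
    · apply subset_closure
      rw [mem_ball_zero_iff]; linarith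
  have h2 : ‖∏ a ∈ s, (z - a) ^ T‖ ≤ (2 * ρ) ^ (T * R) := by
    rw [norm_prod, pow_mul]
    rw [← hcard, ← Finset.prod_const]
    refine Finset.prod_le_prod (fun _ _ => by positivity) fun a ha => ?_
    rw [norm_pow]
    gcongr
    have := norm_sub_le z a
    have := hmem a ha
    linarith
  rw [hQ', norm_mul]
  calc _ ≤ (2 * ρ) ^ (T * R) * (G / (7 * ρ) ^ (T * R)) := by gcongr
    _ = G * (2 / 7) ^ (T * R) := by
      rw [div_pow, mul_pow, mul_pow]
      field_simp
    _ ≤ G * Real.exp (-(R * T)) := by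
      gcongr
      have : Real.exp (-((R : ℝ) * T)) = Real.exp (-1) ^ (T * R) := by
        rw [← Real.exp_nat_mul]; push_cast; ring_nf
      rw [this]
      gcongr
      have := Real.exp_one_lt_d9
      rw [Real.exp_neg, le_inv_comm₀ (by norm_num) (Real.exp_pos _)]
      linarith

open Polynomial in
/-- The exponential polynomial `z ↦ ∑ i, P i z * exp (w i * z)`. -/
noncomputable def expPoly {κ : Type*} [Fintype κ] (w : κ → ℂ) (P : κ → ℂ[X]) (z : ℂ) : ℂ :=
  ∑ i, (P i).eval z * Complex.exp (w i * z)

open Polynomial in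
/-- The action of the differential operator `d/dz - v` on the coefficients of an exponential
polynomial with frequencies `w`. -/
noncomputable def expPolyOp {κ : Type*} (w : κ → ℂ) (v : ℂ) (P : κ → ℂ[X]) (i : κ) : ℂ[X] :=
  derivative (P i) + C (w i - v) * P i

section ExpPoly

open Polynomial

variable {κ : Type*} {w : κ → ℂ}

lemma iterate_expPolyOp_self (i : κ) (P : κ → ℂ[X]) (n : ℕ) :
    (expPolyOp w (w i))^[n] P i = derivative^[n] (P i) := by
  induction n with
  | zero => rfl
  | succ n ih =>
    rw [Function.iterate_succ_apply', Function.iterate_succ_apply', expPolyOp, ih]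
    simp

lemma iterate_expPolyOp_const (v : ℂ) {i : κ} {P : κ → ℂ[X]} {c : ℂ} (h : P i = C c) (n : ℕ) :
    (expPolyOp w v)^[n] P i = C (c * (w i - v) ^ n) := by
  induction n with
  | zero => simpa
  | succ n ih =>
    rw [Function.iterate_succ_apply', expPolyOp, ih, derivative_C, zero_add, ← C_mul]
    congr 1; ring

lemma degree_iterate_expPolyOp_lt (v : ℂ) {i : κ} {P : κ → ℂ[X]} {N : ℕ} (h : (P i).degree < N)
    (n : ℕ) : ((expPolyOp w v)^[n] P i).degree < N := by
  induction n with
  | zero => simpa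
  | succ n ih =>
    rw [Function.iterate_succ_apply', expPolyOp]
    refine (degree_add_le _ _).trans_lt (max_lt ((degree_derivative_le).trans_lt ih) ?_)
    refine (degree_mul_le _ _).trans_lt (lt_of_le_of_lt ?_ ih)
    exact (add_le_add_left degree_C_le _).trans (by simp)

variable [Fintype κ]

lemma hasDerivAt_expPoly (v : ℂ) (P : κ → ℂ[X]) (z : ℂ) :
    HasDerivAt (expPoly w P) (expPoly w (expPolyOp w v P) z + v * expPoly w P z) z := by
  have h : HasDerivAt (expPoly w P) (∑ i, ((derivative (P i)).eval z * Complex.exp (w i * z) +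
      (P i).eval z * (Complex.exp (w i * z) * (w i * 1)))) z := by
    refine HasDerivAt.fun_sum fun i _ => ?_
    exact ((P i).hasDerivAt z).mul (((hasDerivAt_id z).const_mul (w i)).cexp)
  convert h using 1
  simp only [expPoly, expPolyOp, Finset.mul_sum, ← Finset.sum_add_distrib]
  refine Finset.sum_congr rfl fun i _ => ?_
  simp only [eval_add, eval_mul, eval_C]
  ring

lemma norm_expPoly_expPolyOp_le {v : ℂ} {P : κ → ℂ[X]} {ρ ε Ω : ℝ} (hv : ‖v‖ ≤ Ω)
    (h : ∀ z : ℂ, ‖z‖ ≤ ρ → ‖expPoly w P z‖ ≤ ε) {z : ℂ} (hz : ‖z‖ ≤ ρ - 1) :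
    ‖expPoly w (expPolyOp w v P) z‖ ≤ ε * (1 + Ω) := by
  have hd : Differentiable ℂ (expPoly w P) := fun x => (hasDerivAt_expPoly 0 P x).differentiableAt
  have h1 : ‖deriv (expPoly w P) z‖ ≤ ε / 1 := by
    refine Complex.norm_deriv_le_of_forall_mem_sphere_norm_le one_pos hd.diffContOnCl
      fun x hx => h x ?_
    rw [mem_sphere_iff_norm] at hx
    have := norm_le_norm_add_norm_sub' x z
    linarith
  have h2 := h z (by linarith)
  have h3 : expPoly w (expPolyOp w v P) z = deriv (expPoly w P) z - v * expPoly w P z := by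
    rw [(hasDerivAt_expPoly v P z).deriv]; ring
  rw [h3]
  calc _ ≤ ‖deriv (expPoly w P) z‖ + ‖v * expPoly w P z‖ := norm_sub_le _ _
    _ ≤ ε / 1 + Ω * ε := by
      rw [norm_mul]
      gcongr
      exact (norm_nonneg _).trans hv
    _ = _ := by ring

lemma norm_expPoly_iterate_expPolyOp_le {v : ℂ} {P : κ → ℂ[X]} {ρ ε Ω : ℝ} (hv : ‖v‖ ≤ Ω)
    (h : ∀ z : ℂ, ‖z‖ ≤ ρ → ‖expPoly w P z‖ ≤ ε) (n : ℕ) (z : ℂ) (hz : ‖z‖ ≤ ρ - n) :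
    ‖expPoly w ((expPolyOp w v)^[n] P) z‖ ≤ ε * (1 + Ω) ^ n := by
  induction n generalizing z with
  | zero => simpa using h z (by simpa using hz)
  | succ n ih =>
    rw [Function.iterate_succ_apply', pow_succ, ← mul_assoc]
    exact norm_expPoly_expPolyOp_le hv ih (by push_cast at hz; linarith)

/-- The leading coefficient of each polynomial in an exponential polynomial is controlled by
the size of the exponential polynomial on a large disc. -/
lemma norm_factorial_mul_coeff_le [DecidableEq κ] {P : κ → ℂ[X]} {ρ ε Ω δ : ℝ} {N : ℕ} (hδ : 0 < δ)
    (hδ1 : δ ≤ 1) (hΩ : ∀ i, ‖w i‖ ≤ Ω) (hsep : ∀ i j, i ≠ j → δ ≤ ‖w i - w j‖)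
    (hN : ∀ i, (P i).degree < N) (hρ : (N * Fintype.card κ : ℕ) ≤ ρ)
    (h : ∀ z : ℂ, ‖z‖ ≤ ρ → ‖expPoly w P z‖ ≤ ε) (i : κ) :
    ((P i).natDegree.factorial : ℝ) * ‖(P i).leadingCoeff‖ ≤
      ε * ((1 + Ω) / δ) ^ (N * Fintype.card κ) := by
  set d := (P i).natDegree with hd
  set c : ℂ := d.factorial * (P i).leadingCoeff with hc
  have hΩ0 : 0 ≤ Ω := (norm_nonneg _).trans (hΩ i)
  have hε0 : 0 ≤ ε := (norm_nonneg _).trans (h 0 (by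
    rw [norm_zero]; exact le_trans (Nat.cast_nonneg _) hρ))
  by_cases hPi : P i = 0
  · simp only [hPi, leadingCoeff_zero, norm_zero, mul_zero]; positivity
  have hdN : d < N := by
    have := hN i
    rwa [degree_eq_natDegree hPi, Nat.cast_lt] at this
  have key : ∀ s : Finset κ, i ∉ s → ∃ P' : κ → ℂ[X], (∀ j ∈ s, P' j = 0) ∧
      (∀ j, (P' j).degree < N) ∧ P' i = C (c * ∏ j ∈ s, (w i - w j) ^ N) ∧
      ∀ z : ℂ, ‖z‖ ≤ ρ - (d + N * s.card : ℕ) →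
        ‖expPoly w P' z‖ ≤ ε * (1 + Ω) ^ (d + N * s.card) := by
    intro s
    induction s using Finset.induction_on with
    | empty =>
      intro _
      refine ⟨(expPolyOp w (w i))^[d] P, by simp, fun j => degree_iterate_expPolyOp_lt _ (hN j) _,
        ?_, fun z hz => norm_expPoly_iterate_expPolyOp_le (hΩ i) h _ z (by simpa using hz)⟩
      rw [iterate_expPolyOp_self, Finset.prod_empty, mul_one]
      have h0 : (derivative^[d] (P i)).natDegree ≤ 0 := by
        have := natDegree_iterate_derivative (P i) d
        omega
      rw [eq_C_of_natDegree_le_zero h0, coeff_iterate_derivative, hc]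
      rw [zero_add, Nat.descFactorial_self, nsmul_eq_mul, hd, coeff_natDegree]
    | insert b s hb ih =>
      intro hi
      rw [Finset.mem_insert, not_or] at hi
      obtain ⟨P', h1, h2, h3, h4⟩ := ih hi.2
      refine ⟨(expPolyOp w (w b))^[N] P', fun j hj => ?_,
        fun j => degree_iterate_expPolyOp_lt _ (h2 j) _, ?_, fun z hz => ?_⟩
      · rw [Finset.mem_insert] at hj
        rcases hj with rfl | hj
        · rw [iterate_expPolyOp_self]
          by_cases hz : P' j = 0
          · rw [hz, iterate_derivative_zero]
          · refine iterate_derivative_eq_zero ?_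
            have := h2 j
            rwa [degree_eq_natDegree hz, Nat.cast_lt] at this
        · have := iterate_expPolyOp_const (w := w) (w b) (P := P') (i := j) (c := 0)
            (by simpa using h1 j hj) N
          simpa using this
      · rw [iterate_expPolyOp_const (w b) h3, Finset.prod_insert hb]
        congr 1; ring
      · rw [Finset.card_insert_of_notMem hb] at hz ⊢
        have := norm_expPoly_iterate_expPolyOp_le (hΩ b) h4 N z (by
          push_cast at hz ⊢; linarith)
        refine this.trans (le_of_eq ?_)
        rw [mul_assoc, ← pow_add, mul_add, mul_one, ← add_assoc]
  obtain ⟨P', h1, -, h3, h4⟩ := key (Finset.univ.erase i) (Finset.notMem_erase _ _)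
  have hcard : (Finset.univ.erase i).card + 1 = Fintype.card κ := by
    rw [Finset.card_erase_add_one (Finset.mem_univ i), Finset.card_univ]
  have hle : d + N * (Finset.univ.erase i).card ≤ N * Fintype.card κ := by
    rw [← hcard, mul_add, mul_one]; omega
  have h5 := h4 0 (by
    rw [norm_zero, sub_nonneg]
    exact le_trans (by exact_mod_cast hle) hρ)
  have h6 : expPoly w P' 0 = c * ∏ j ∈ Finset.univ.erase i, (w i - w j) ^ N := by
    rw [expPoly, Finset.sum_eq_single i]
    · rw [h3, eval_C, mul_zero, Complex.exp_zero, mul_one]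
    · intro j _ hj
      rw [h1 j (Finset.mem_erase.2 ⟨hj, Finset.mem_univ _⟩)]; simp
    · simp
  rw [h6, norm_mul, norm_prod] at h5
  have h7 : δ ^ (N * Fintype.card κ) ≤ ∏ j ∈ Finset.univ.erase i, ‖(w i - w j) ^ N‖ := by
    calc δ ^ (N * Fintype.card κ) ≤ δ ^ (N * (Finset.univ.erase i).card) :=
          pow_le_pow_of_le_one hδ.le hδ1 (by omega)
      _ = ∏ j ∈ Finset.univ.erase i, δ ^ N := by rw [Finset.prod_const, pow_mul]
      _ ≤ _ := by
        refine Finset.prod_le_prod (fun _ _ => by positivity) fun j hj => ?_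
        rw [norm_pow]
        gcongr
        exact hsep i j (Finset.ne_of_mem_erase hj).symm
  have h8 : ‖c‖ = (d.factorial : ℝ) * ‖(P i).leadingCoeff‖ := by
    rw [hc, norm_mul, Complex.norm_natCast]
  rw [← h8, div_pow, mul_div_assoc', le_div_iff₀ (by positivity)]
  calc ‖c‖ * δ ^ (N * Fintype.card κ) ≤ _ := by gcongr
    _ ≤ _ := h5
    _ ≤ _ := by
      gcongr
      linarith

end ExpPoly

section BinomPoly

open Polynomial

/-- The binomial polynomial `X (X - 1) ⋯ (X - a + 1) / a!`. -/
noncomputable def binomPoly (a : ℕ) : ℂ[X] :=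
  C ((a.factorial : ℂ)⁻¹) * descPochhammer ℂ a

lemma binomPoly_zero : binomPoly 0 = 1 := by simp [binomPoly]

lemma eval_natCast_binomPoly (a r : ℕ) : (binomPoly a).eval (r : ℂ) = r.choose a := by
  rw [binomPoly, eval_mul, eval_C, descPochhammer_eval_eq_descFactorial,
    Nat.descFactorial_eq_factorial_mul_choose]
  push_cast
  rw [inv_mul_cancel_left₀ (by exact_mod_cast a.factorial_ne_zero)]

lemma binomPoly_comp_X_add_one (a : ℕ) :
    (binomPoly (a + 1)).comp (X + 1) = binomPoly (a + 1) + binomPoly a := by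
  refine eq_of_infinite_eval_eq _ _ ((Set.infinite_range_of_injective
    (Nat.cast_injective (R := ℂ))).mono ?_)
  rintro _ ⟨r, rfl⟩
  simp only [Set.mem_ofPred_eq, eval_comp, eval_add, eval_X, eval_one]
  rw [← Nat.cast_succ, eval_natCast_binomPoly, eval_natCast_binomPoly, eval_natCast_binomPoly,
    Nat.choose_succ_succ, add_comm]
  push_cast; ring

lemma eval_zero_derivative_binomPoly (a : ℕ) :
    (derivative (binomPoly (a + 1))).eval 0 = (-1) ^ a / (a + 1) := by
  rw [binomPoly, derivative_C_mul, descPochhammer_succ_left, derivative_mul]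
  simp only [derivative_X, eval_mul, eval_C, eval_add, eval_X, eval_one, zero_mul, add_zero,
    one_mul, eval_comp, eval_sub, zero_sub]
  have h : ∀ n : ℕ, (descPochhammer ℂ n).eval (-1) = (-1) ^ n * n.factorial := by
    intro n
    induction n with
    | zero => simp
    | succ n ih =>
      rw [descPochhammer_succ_eval, ih, Nat.factorial_succ, pow_succ]
      push_cast; ring
  rw [h, Nat.factorial_succ]
  have : (a.factorial : ℂ) ≠ 0 := by exact_mod_cast a.factorial_ne_zero
  have : (a : ℂ) + 1 ≠ 0 := by exact_mod_cast a.succ_ne_zero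
  push_cast
  field_simp

lemma derivative_binomPoly (a : ℕ) :
    derivative (binomPoly a) =
      ∑ m ∈ Finset.range a, C ((-1) ^ m / (m + 1) : ℂ) * binomPoly (a - 1 - m) := by
  induction a with
  | zero => simp [binomPoly]
  | succ a ih =>
    refine eq_of_infinite_eval_eq _ _ ((Set.infinite_range_of_injective
      (Nat.cast_injective (R := ℂ))).mono ?_)
    rintro _ ⟨r, rfl⟩
    rw [Set.mem_ofPred_eq]
    induction r with
    | zero =>
      rw [Nat.cast_zero, eval_zero_derivative_binomPoly, eval_finsetSum,
        Finset.sum_range_succ, Finset.sum_eq_zero]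
      · simp [binomPoly_zero]
      · intro m hm
        rw [Finset.mem_range] at hm
        have h := eval_natCast_binomPoly (a + 1 - 1 - m) 0
        rw [Nat.cast_zero] at h
        rw [eval_mul, h, Nat.choose_eq_zero_of_lt (by omega)]
        simp
    | succ r hr =>
      have h1 : (derivative (binomPoly (a + 1))).eval ((r + 1 : ℕ) : ℂ) =
          (derivative (binomPoly (a + 1))).eval (r : ℂ) +
            (derivative (binomPoly a)).eval (r : ℂ) := by
        have := congrArg (fun p => (derivative p).eval (r : ℂ)) (binomPoly_comp_X_add_one a)
        simpa [derivative_comp] using this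
      rw [h1, hr, ih, eval_finsetSum, eval_finsetSum, eval_finsetSum, Finset.sum_range_succ,
        Finset.sum_range_succ, add_right_comm, ← Finset.sum_add_distrib]
      congr 1
      · refine Finset.sum_congr rfl fun m hm => ?_
        rw [Finset.mem_range] at hm
        simp only [eval_mul, eval_C, eval_natCast_binomPoly]
        rw [show a + 1 - 1 - m = (a - 1 - m) + 1 by omega, Nat.choose_succ_succ']
        push_cast; ring
      · simp [binomPoly_zero]

/-- All derivatives of `P` become integral at natural numbers after multiplication of the `j`-th
derivative by `d ^ j`. -/
def HasIntegralDerivatives (d : ℕ) (P : ℂ[X]) : Prop :=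
  ∀ j r : ℕ, ∃ k : ℤ, (d : ℂ) ^ j * (derivative^[j] P).eval (r : ℂ) = k

lemma HasIntegralDerivatives.mul {d : ℕ} {P Q : ℂ[X]} (hP : HasIntegralDerivatives d P)
    (hQ : HasIntegralDerivatives d Q) : HasIntegralDerivatives d (P * Q) := by
  intro j r
  choose f hf using hP
  choose g hg using hQ
  refine ⟨∑ k ∈ Finset.range j.succ, j.choose k * (f (j - k) r * g k r), ?_⟩
  rw [iterate_derivative_mul, eval_finsetSum, Finset.mul_sum]
  push_cast
  refine Finset.sum_congr rfl fun k hk => ?_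
  rw [← hf, ← hg, nsmul_eq_mul, eval_mul, eval_mul, eval_natCast]
  rw [Finset.mem_range] at hk
  have : (d : ℂ) ^ j = d ^ (j - k) * d ^ k := by rw [← pow_add]; congr 1; omega
  rw [this]; ring

lemma HasIntegralDerivatives.one (d : ℕ) : HasIntegralDerivatives d 1 := by
  intro j r
  cases j with
  | zero => exact ⟨1, by simp⟩
  | succ j => exact ⟨0, by simp⟩

lemma HasIntegralDerivatives.pow {d : ℕ} {P : ℂ[X]} (hP : HasIntegralDerivatives d P) (n : ℕ) :
    HasIntegralDerivatives d (P ^ n) := by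
  induction n with
  | zero => simpa using HasIntegralDerivatives.one d
  | succ n ih => rw [pow_succ]; exact ih.mul hP

lemma hasIntegralDerivatives_binomPoly {a h : ℕ} (ha : a ≤ h) :
    HasIntegralDerivatives h.lcmUpto (binomPoly a) := by
  intro j
  induction j generalizing a with
  | zero => intro r; exact ⟨r.choose a, by simp [eval_natCast_binomPoly]⟩
  | succ j ih =>
    intro r
    have hdvd : ∀ m ∈ Finset.range a, ∃ t : ℕ, h.lcmUpto = (m + 1) * t := by
      intro m hm
      rw [Finset.mem_range] at hm
      exact Finset.dvd_lcm (f := id) (by rw [Finset.mem_Icc]; omega)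
    choose! t ht using hdvd
    have ih' : ∀ m : ℕ, ∃ k : ℤ, m ∈ Finset.range a →
        (h.lcmUpto : ℂ) ^ j * (derivative^[j] (binomPoly (a - 1 - m))).eval (r : ℂ) = k := by
      intro m
      by_cases hm : m ∈ Finset.range a
      · obtain ⟨k, hk⟩ := ih (a := a - 1 - m) (by omega) r
        exact ⟨k, fun _ => hk⟩
      · exact ⟨0, fun h => absurd h hm⟩
    choose k hk using ih'
    refine ⟨∑ m ∈ Finset.range a, (-1) ^ m * t m * k m, ?_⟩
    rw [Function.iterate_succ_apply, derivative_binomPoly, iterate_derivative_sum, eval_finsetSum,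
      Finset.mul_sum]
    push_cast
    refine Finset.sum_congr rfl fun m hm => ?_
    rw [← hk m hm, iterate_derivative_C_mul, eval_mul, eval_C, pow_succ]
    have h1 : (h.lcmUpto : ℂ) = (m + 1) * t m := by exact_mod_cast ht m hm
    have : (m : ℂ) + 1 ≠ 0 := by exact_mod_cast m.succ_ne_zero
    have h2 : (h.lcmUpto : ℂ) * ((-1) ^ m / (m + 1)) = (-1) ^ m * t m := by
      rw [h1]; field_simp
    linear_combination ((h.lcmUpto : ℂ) ^ j *
      (derivative^[j] (binomPoly (a - 1 - m))).eval (r : ℂ)) * h2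

lemma natDegree_binomPoly (a : ℕ) : (binomPoly a).natDegree = a := by
  rw [binomPoly, natDegree_C_mul (inv_ne_zero (by exact_mod_cast a.factorial_ne_zero)),
    descPochhammer_natDegree]

lemma leadingCoeff_binomPoly (a : ℕ) : (binomPoly a).leadingCoeff = (a.factorial : ℂ)⁻¹ := by
  rw [binomPoly, leadingCoeff_mul, leadingCoeff_C, (monic_descPochhammer ℂ a).leadingCoeff, mul_one]

lemma norm_eval_binomPoly_le {a h : ℕ} (ha : a ≤ h) (hh : 0 < h) {y : ℝ} (hy : 0 ≤ y) {z : ℂ}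
    (hz : ‖z‖ ≤ h * Real.exp y) : ‖(binomPoly a).eval z‖ ≤ Real.exp (h * (y + 2)) := by
  have hh0 : (0 : ℝ) < h := by exact_mod_cast hh
  rw [binomPoly, eval_mul, eval_C, descPochhammer_eval_eq_prod_range, norm_mul, norm_inv,
    Complex.norm_natCast, norm_prod]
  have hle : ∀ i ∈ Finset.range a, ‖z - (i : ℂ)‖ ≤ h * Real.exp (y + 1) := by
    intro i hi
    rw [Finset.mem_range] at hi
    have h1 := norm_sub_le z (i : ℂ)
    rw [Complex.norm_natCast] at h1
    have h2 : (i : ℝ) ≤ h := by exact_mod_cast (by omega)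
    have h3 : 2 * Real.exp y ≤ Real.exp (y + 1) := by
      rw [Real.exp_add, mul_comm]
      gcongr
      linarith [Real.add_one_le_exp 1]
    have h4 := Real.one_le_exp hy
    nlinarith
  calc ((a.factorial : ℝ))⁻¹ * ∏ i ∈ Finset.range a, ‖z - (i : ℂ)‖
      ≤ ((a.factorial : ℝ))⁻¹ * ∏ i ∈ Finset.range a, (h * Real.exp (y + 1)) := by
        gcongr with i hi
        exact hle i hi
    _ = ((h : ℝ) ^ a / a.factorial) * Real.exp (y + 1) ^ a := by
        rw [Finset.prod_const, Finset.card_range, mul_pow]; ring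
    _ ≤ Real.exp h * Real.exp (y + 1) ^ h := by
        gcongr
        · exact Real.pow_div_factorial_le_exp _ hh0.le _
        · exact Real.one_le_exp (by positivity)
    _ = Real.exp (h * (y + 2)) := by
        rw [← Real.exp_nat_mul, ← Real.exp_add]; ring_nf

/-- Feldman's basis of polynomials: `feldmanPoly h e` has degree `e`, and its derivatives at
natural numbers have small denominators. -/
noncomputable def feldmanPoly (h e : ℕ) : ℂ[X] := binomPoly (e % h) * binomPoly h ^ (e / h)

lemma hasIntegralDerivatives_feldmanPoly {h : ℕ} (hh : 0 < h) (e : ℕ) :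
    HasIntegralDerivatives h.lcmUpto (feldmanPoly h e) :=
  (hasIntegralDerivatives_binomPoly (Nat.mod_lt _ hh).le).mul
    ((hasIntegralDerivatives_binomPoly le_rfl).pow _)

lemma binomPoly_ne_zero (a : ℕ) : binomPoly a ≠ 0 := by
  rw [← leadingCoeff_ne_zero, leadingCoeff_binomPoly]
  exact inv_ne_zero (by exact_mod_cast a.factorial_ne_zero)

lemma natDegree_feldmanPoly (h e : ℕ) : (feldmanPoly h e).natDegree = e := by
  rw [feldmanPoly, natDegree_mul (binomPoly_ne_zero _) (pow_ne_zero _ (binomPoly_ne_zero _)),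
    natDegree_pow, natDegree_binomPoly, natDegree_binomPoly, mul_comm, Nat.mod_add_div]

lemma feldmanPoly_ne_zero (h e : ℕ) : feldmanPoly h e ≠ 0 :=
  mul_ne_zero (binomPoly_ne_zero _) (pow_ne_zero _ (binomPoly_ne_zero _))

lemma Nat.factorial_pow_dvd_factorial_mul (h b : ℕ) : h.factorial ^ b ∣ (h * b).factorial := by
  induction b with
  | zero => simp
  | succ b ih =>
    rw [pow_succ, mul_add, mul_one]
    exact (mul_dvd_mul ih dvd_rfl).trans (Nat.factorial_mul_factorial_dvd_factorial_add _ _)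

lemma one_le_factorial_mul_norm_leadingCoeff_feldmanPoly (h e : ℕ) :
    1 ≤ (e.factorial : ℝ) * ‖(feldmanPoly h e).leadingCoeff‖ := by
  rw [feldmanPoly, leadingCoeff_mul, leadingCoeff_pow, leadingCoeff_binomPoly,
    leadingCoeff_binomPoly, norm_mul, norm_pow, norm_inv, norm_inv, Complex.norm_natCast,
    Complex.norm_natCast, inv_pow, ← mul_inv, ← div_eq_mul_inv, one_le_div (by positivity)]
  have h1 : (e % h).factorial * h.factorial ^ (e / h) ∣ e.factorial := by
    conv_rhs => rw [← Nat.mod_add_div e h]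
    exact (mul_dvd_mul dvd_rfl (Nat.factorial_pow_dvd_factorial_mul _ _)).trans
      (Nat.factorial_mul_factorial_dvd_factorial_add _ _)
  exact_mod_cast Nat.le_of_dvd e.factorial_pos h1

lemma norm_eval_feldmanPoly_le {h e L : ℕ} (hh : 0 < h) (he : e < h * L) {y : ℝ} (hy : 0 ≤ y)
    {z : ℂ} (hz : ‖z‖ ≤ h * Real.exp y) :
    ‖(feldmanPoly h e).eval z‖ ≤ Real.exp (h * L * (y + 2)) := by
  rw [feldmanPoly, eval_mul, eval_pow, norm_mul, norm_pow]
  have hb : e / h + 1 ≤ L := Nat.div_lt_of_lt_mul he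
  calc _ ≤ Real.exp (h * (y + 2)) * Real.exp (h * (y + 2)) ^ (e / h) := by
        gcongr
        · exact norm_eval_binomPoly_le (Nat.mod_lt _ hh).le hh hy hz
        · exact norm_eval_binomPoly_le le_rfl hh hy hz
    _ = Real.exp (h * (y + 2)) ^ (e / h + 1) := by rw [pow_succ']
    _ ≤ Real.exp (h * (y + 2)) ^ L := by
        gcongr
        exact Real.one_le_exp (by positivity)
    _ = Real.exp (h * L * (y + 2)) := by
        rw [← Real.exp_nat_mul]; ring_nf

lemma norm_eval_iterate_derivative_feldmanPoly_le {h e L : ℕ} (hh : 0 < h) (he : e < h * L) {y : ℝ}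
    (hy : 0 ≤ y) {z : ℂ} (hz : ‖z‖ + 1 ≤ h * Real.exp y) (j : ℕ) :
    ‖(derivative^[j] (feldmanPoly h e)).eval z‖ ≤
      j.factorial * Real.exp (h * L * (y + 2)) := by
  have h1 := Complex.norm_iteratedDeriv_le_of_forall_mem_sphere_norm_le (c := z) (n := j)
    (F := ℂ) (f := fun x => (feldmanPoly h e).eval x) (C := Real.exp (h * L * (y + 2)))
    one_pos (by
      apply Differentiable.diffContOnCl
      exact (feldmanPoly h e).differentiable) (fun x hx => by
      refine norm_eval_feldmanPoly_le hh he hy ?_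
      rw [mem_sphere_iff_norm] at hx
      have := norm_le_norm_add_norm_sub' x z
      linarith)
  have h2 : ∀ (j : ℕ) (P : ℂ[X]), iteratedDeriv j (fun x => P.eval x) =
      fun x => (derivative^[j] P).eval x := by
    intro j
    induction j with
    | zero => intro P; simp
    | succ j ih =>
      intro P
      rw [iteratedDeriv_succ', Function.iterate_succ_apply, ← ih]
      congr 1
      funext x
      exact P.deriv
  rw [h2] at h1
  simpa using h1

end BinomPoly

lemma Nat.lcmUpto_le_exp (h : ℕ) : (h.lcmUpto : ℝ) ≤ Real.exp (6 * h) := by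
  have h0 : (0 : ℝ) < h.lcmUpto := by exact_mod_cast h.lcmUpto_pos
  rw [← Real.log_le_iff_le_exp h0, ← Chebyshev.psi_eq_log_lcmUpto]
  refine (Chebyshev.psi_le_const_mul_self (Nat.cast_nonneg h)).trans ?_
  gcongr
  have : Real.log 4 = 2 * Real.log 2 := by
    rw [show (4 : ℝ) = 2 ^ 2 by norm_num, Real.log_pow]; norm_num
  rw [this]
  linarith [Real.log_two_lt_d9]

/-- Siegel's lemma for complex linear forms: there is a small nonzero integral vector at which all
forms are small. -/
lemma exists_int_vec_norm_sum_le {κ ι : Type} [Fintype κ] [Nonempty κ] [Fintype ι]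
    (a : κ → ι → ℂ) {A K X E : ℝ} (hK : 0 < K) (ha : ∀ k i, ‖a k i‖ ≤ A)
    (hX : Fintype.card ι * (K * A + 1) ≤ Real.exp X) (hX0 : 0 ≤ X) (hE : 0 < E)
    (hcard : 2 * Fintype.card κ * (E + 1) ≤ Fintype.card ι) :
    ∃ p : ι → ℤ, p ≠ 0 ∧ (∀ i, |(p i : ℝ)| ≤ Real.exp (X / E)) ∧
      ∀ k, ‖∑ i, (p i : ℂ) * a k i‖ ≤ 2 * Fintype.card ι * Real.exp (X / E) / K := by
  classical
  set B : Matrix (κ ⊕ κ) ι ℤ :=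
    Matrix.of (Sum.elim (fun k i => ⌊K * (a k i).re⌋) (fun k i => ⌊K * (a k i).im⌋)) with hB
  have hκ : 0 < Fintype.card κ := Fintype.card_pos
  have hm : Fintype.card (κ ⊕ κ) = 2 * Fintype.card κ := by rw [Fintype.card_sum, two_mul]
  have hκ' : (0 : ℝ) < Fintype.card κ := by exact_mod_cast hκ
  have hlt' : (2 * Fintype.card κ : ℝ) < Fintype.card ι := by nlinarith
  have hn : Fintype.card (κ ⊕ κ) < Fintype.card ι := by
    rw [hm]; exact_mod_cast hlt'
  have hι : 0 < Fintype.card ι := by omega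
  have : Nonempty ι := Fintype.card_pos_iff.mp hι
  have hA : 0 ≤ A := (norm_nonneg _).trans (ha (Classical.arbitrary κ) (Classical.arbitrary ι))
  let := Matrix.seminormedAddCommGroup (m := κ ⊕ κ) (n := ι) (α := ℤ)
  obtain ⟨p, hp0, hp, hpn⟩ := Int.Matrix.exists_ne_zero_int_vec_norm_le B hn (by omega)
  have hfloor : ∀ x : ℝ, |x| ≤ A → ‖⌊K * x⌋‖ ≤ K * A + 1 := by
    intro x hx
    rw [Int.norm_eq_abs, abs_le]
    have h1 := Int.floor_le (K * x)
    have h2 := Int.lt_floor_add_one (K * x)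
    rw [abs_le] at hx
    constructor <;> nlinarith
  have hBn : max 1 ‖B‖ ≤ K * A + 1 := by
    refine max_le (by nlinarith) ((Matrix.norm_le_iff (by positivity)).2 ?_)
    rintro (k | k) i
    · exact hfloor _ ((Complex.abs_re_le_norm _).trans (ha k i))
    · exact hfloor _ ((Complex.abs_im_le_norm _).trans (ha k i))
  have hpb : ‖p‖ ≤ Real.exp (X / E) := by
    refine hpn.trans ?_
    calc _ ≤ (Real.exp X) ^ ((Fintype.card (κ ⊕ κ) : ℝ) /
          (Fintype.card ι - Fintype.card (κ ⊕ κ))) := by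
          refine Real.rpow_le_rpow (by positivity) ?_ ?_
          · exact (mul_le_mul_of_nonneg_left hBn (by positivity)).trans hX
          · have : (Fintype.card (κ ⊕ κ) : ℝ) < Fintype.card ι := by exact_mod_cast hn
            exact div_nonneg (by positivity) (by linarith)
      _ ≤ _ := by
          rw [← Real.exp_mul, Real.exp_le_exp, div_eq_mul_inv X E]
          refine mul_le_mul_of_nonneg_left ?_ hX0
          rw [hm, ← one_div, div_le_div_iff₀ (by push_cast; linarith) hE]
          push_cast; linarith
  have hpi : ∀ i, |(p i : ℝ)| ≤ Real.exp (X / E) := fun i => by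
    rw [← Int.norm_eq_abs]; exact (norm_le_pi_norm p i).trans hpb
  refine ⟨p, hp0, hpi, fun k => ?_⟩
  have key : ∀ x : ι → ℝ, (∑ i, ⌊K * x i⌋ * p i = 0) →
      |∑ i, (p i : ℝ) * x i| ≤ Fintype.card ι * Real.exp (X / E) / K := by
    intro x hx
    rw [le_div_iff₀ hK]
    nth_rewrite 1 [← abs_of_pos hK]
    rw [← abs_mul]
    have hx' : ∑ i, (⌊K * x i⌋ : ℝ) * p i = 0 := by exact_mod_cast hx
    have : (∑ i, (p i : ℝ) * x i) * K = ∑ i, (p i : ℝ) * Int.fract (K * x i) := by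
      rw [Finset.sum_mul, ← sub_zero (∑ i, _), ← hx', ← Finset.sum_sub_distrib]
      refine Finset.sum_congr rfl fun i _ => ?_
      rw [Int.fract]; ring
    rw [this]
    refine (Finset.abs_sum_le_sum_abs _ _).trans ?_
    calc _ ≤ ∑ i : ι, Real.exp (X / E) := by
          refine Finset.sum_le_sum fun i _ => ?_
          rw [abs_mul, abs_of_nonneg (Int.fract_nonneg (K * x i))]
          exact (mul_le_of_le_one_right (abs_nonneg _) (Int.fract_lt_one _).le).trans (hpi i)
      _ = _ := by simp
  have hre := key (fun i => (a k i).re) (by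
    simpa [Matrix.mulVec, dotProduct, hB] using congrFun hp (Sum.inl k))
  have him := key (fun i => (a k i).im) (by
    simpa [Matrix.mulVec, dotProduct, hB] using congrFun hp (Sum.inr k))
  refine (Complex.norm_le_abs_re_add_abs_im _).trans ?_
  have e1 : (∑ i, (p i : ℂ) * a k i).re = ∑ i, (p i : ℝ) * (a k i).re := by simp
  have e2 : (∑ i, (p i : ℂ) * a k i).im = ∑ i, (p i : ℝ) * (a k i).im := by simp
  rw [e1, e2]
  calc _ ≤ _ := add_le_add hre him
    _ = _ := by ring

/-- A truncation of the Taylor expansion of `z - log (exp (2 * π * I * z)) / (2 * π * I)` in powers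
of `exp (2 * π * I * z) - 1`: an entire function fixing `ℤ`, nearly constant close to `ℤ`. -/
noncomputable def flatId (n : ℕ) (z : ℂ) : ℂ :=
  z - (2 * π * Complex.I)⁻¹ *
    ∑ j ∈ Finset.range n, (-1) ^ j * (Complex.exp (2 * π * Complex.I * z) - 1) ^ (j + 1) / (j + 1)

lemma flatId_natCast (n r : ℕ) : flatId n r = r := by
  have h : Complex.exp (2 * π * Complex.I * r) = 1 := by
    rw [mul_comm, Complex.exp_nat_mul_two_pi_mul_I]
  simp [flatId, h]

lemma hasDerivAt_flatId (n : ℕ) (z : ℂ) :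
    HasDerivAt (flatId n) ((1 - Complex.exp (2 * π * Complex.I * z)) ^ n) z := by
  set E := Complex.exp (2 * π * Complex.I * z) with hE
  have hexp : HasDerivAt (fun z => Complex.exp (2 * π * Complex.I * z) - 1)
      (E * (2 * π * Complex.I)) z := by
    simpa using (((hasDerivAt_id z).const_mul (2 * π * Complex.I)).cexp).sub_const 1
  have hsum := HasDerivAt.fun_sum (u := Finset.range n) (x := z) fun j _ =>
    ((hexp.pow (j + 1)).const_mul ((-1 : ℂ) ^ j)).div_const ((j : ℂ) + 1)
  have h := (hasDerivAt_id z).sub (hsum.const_mul (2 * π * Complex.I)⁻¹)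
  refine h.congr_deriv ?_
  have hgeom := mul_neg_geom_sum (1 - E) n
  have hπ : (2 * π * Complex.I : ℂ) ≠ 0 := Complex.two_pi_I_ne_zero
  have : ∀ j : ℕ, (-1 : ℂ) ^ j * (((j + 1 : ℕ) : ℂ) * (E - 1) ^ (j + 1 - 1) *
      (E * (2 * π * Complex.I))) / ((j : ℂ) + 1) = (2 * π * Complex.I) * (E * (1 - E) ^ j) := by
    intro j
    have hj : (j : ℂ) + 1 ≠ 0 := by exact_mod_cast j.succ_ne_zero
    rw [show 1 - E = -1 * (E - 1) by ring, mul_pow, Nat.add_sub_cancel]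
    push_cast
    field_simp
  simp only [← hE, this]
  rw [← Finset.mul_sum, inv_mul_cancel_left₀ hπ, ← Finset.mul_sum]
  linear_combination -hgeom

lemma differentiable_flatId (n : ℕ) : Differentiable ℂ (flatId n) := fun z =>
  (hasDerivAt_flatId n z).differentiableAt

lemma le_analyticOrderAt_deriv_flatId (n r : ℕ) :
    (n : ℕ∞) ≤ analyticOrderAt (deriv (flatId n)) r := by
  have h1 : deriv (flatId n) = (fun z => 1 - Complex.exp (2 * π * Complex.I * z)) ^ n := by
    funext z
    simpa using (hasDerivAt_flatId n z).deriv
  have han : AnalyticAt ℂ (fun z => 1 - Complex.exp (2 * π * Complex.I * z)) r := by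
    fun_prop
  have h0 : (1 : ℕ∞) ≤ analyticOrderAt (fun z => 1 - Complex.exp (2 * π * Complex.I * z)) r := by
    rw [Order.one_le_iff_ne_zero, ne_eq, han.analyticOrderAt_eq_zero, not_not, sub_eq_zero,
      mul_comm, Complex.exp_nat_mul_two_pi_mul_I]
  rw [h1, analyticOrderAt_pow han, nsmul_eq_mul]
  exact le_mul_of_one_le_right (zero_le) h0

lemma norm_flatId_le {n : ℕ} {Z : ℝ} (hn : 1 ≤ n) (hZ : 1 ≤ Z) {z : ℂ} (hz : ‖z‖ ≤ Z) :
    ‖flatId n z‖ ≤ Real.exp (9 * n * Z) := by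
  have hn' : (1 : ℝ) ≤ n := by exact_mod_cast hn
  have hπ : 2 * π ≤ 7 := by linarith [Real.pi_lt_d2]
  have hπ' : 1 ≤ 2 * π := by linarith [Real.pi_gt_three]
  have hw : ‖Complex.exp (2 * π * Complex.I * z) - 1‖ ≤ Real.exp (7 * Z + 1) := by
    refine (norm_sub_le _ _).trans ?_
    have h1 : ‖Complex.exp (2 * π * Complex.I * z)‖ ≤ Real.exp (7 * Z) := by
      refine (Complex.norm_exp_le_exp_norm _).trans (Real.exp_le_exp.2 ?_)
      simp only [norm_mul, Complex.norm_I, Complex.norm_real, Complex.norm_ofNat, norm_eq_abs,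
        abs_of_pos Real.pi_pos, mul_one]
      gcongr
    rw [norm_one, Real.exp_add]
    have h2 := Real.add_one_le_exp 1
    have h3 : 1 ≤ Real.exp (7 * Z) := Real.one_le_exp (by linarith)
    nlinarith
  have hsum : ‖∑ j ∈ Finset.range n,
      (-1) ^ j * (Complex.exp (2 * π * Complex.I * z) - 1) ^ (j + 1) / ((j : ℂ) + 1)‖ ≤
      n * Real.exp (n * (7 * Z + 1)) := by
    refine (norm_sum_le_of_le (f := fun j : ℕ =>
      (-1) ^ j * (Complex.exp (2 * π * Complex.I * z) - 1) ^ (j + 1) / ((j : ℂ) + 1))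
      (Finset.range n) (n := fun _ => Real.exp (n * (7 * Z + 1)))
      fun j hj => ?_).trans (by simp)
    rw [Finset.mem_range] at hj
    have hj1 : ‖(j : ℂ) + 1‖ = (j : ℝ) + 1 := by
      rw [← Nat.cast_succ, Complex.norm_natCast, Nat.cast_succ]
    rw [norm_div, norm_mul, norm_pow, norm_neg, norm_one, one_pow, one_mul, norm_pow, hj1]
    refine (div_le_self (by positivity) (by linarith [(Nat.cast_nonneg j : (0 : ℝ) ≤ j)])).trans ?_
    calc _ ≤ Real.exp (7 * Z + 1) ^ (j + 1) := by gcongr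
      _ ≤ Real.exp (7 * Z + 1) ^ n := by
        gcongr
        · exact Real.one_le_exp (by linarith)
        · omega
      _ = _ := by rw [← Real.exp_nat_mul]
  rw [flatId]
  refine (norm_sub_le _ _).trans ?_
  have hinv : ‖(2 * π * Complex.I : ℂ)⁻¹‖ ≤ 1 := by
    rw [norm_inv]
    refine inv_le_one_of_one_le₀ ?_
    simpa [abs_of_pos Real.pi_pos] using hπ'
  rw [norm_mul]
  have h1 : 2 * Z ≤ Real.exp (9 * n * Z) := by
    have := Real.add_one_le_exp (9 * n * Z)
    nlinarith
  have h2 : 2 * (n * Real.exp (n * (7 * Z + 1))) ≤ Real.exp (9 * n * Z) := by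
    have h3 : 2 * (n : ℝ) ≤ Real.exp n := by
      have h4 := Real.add_one_le_exp ((n : ℝ) - 1)
      have h5 : Real.exp n = Real.exp (n - 1) * Real.exp 1 := by rw [← Real.exp_add]; ring_nf
      have h6 := Real.add_one_le_exp 1
      rw [h5]; nlinarith
    calc _ = 2 * (n : ℝ) * Real.exp (n * (7 * Z + 1)) := by ring
      _ ≤ Real.exp n * Real.exp (n * (7 * Z + 1)) := by gcongr
      _ ≤ _ := by
        rw [← Real.exp_add]
        gcongr
        nlinarith
  nlinarith [norm_nonneg (∑ j ∈ Finset.range n,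
      (-1) ^ j * (Complex.exp (2 * π * Complex.I * z) - 1) ^ (j + 1) / ((j : ℂ) + 1))]

section AuxFun

open Polynomial

variable {ι : Type} [Fintype ι]

/-- The auxiliary function of Baker's method, differentiated `a`, `b` and `c` times in the
polynomial variable and in the two exponential directions. -/
noncomputable def auxFun (p g₁ g₂ w k : ι → ℂ) (P : ι → ℂ[X]) (s : ℂ → ℂ) (a b c : ℕ) (z : ℂ) :
    ℂ :=
  ∑ i, p i * g₁ i ^ b * g₂ i ^ c * (derivative^[a] (P i)).eval z * Complex.exp (w i * z + k i * s z)

variable {p g₁ g₂ w k : ι → ℂ} {P : ι → ℂ[X]} {s : ℂ → ℂ}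

lemma differentiable_auxFun (hs : Differentiable ℂ s) (a b c : ℕ) :
    Differentiable ℂ (auxFun p g₁ g₂ w k P s a b c) := by
  unfold auxFun
  fun_prop

lemma hasDerivAt_auxFun {c₁ c₂ : ℂ} (hw : ∀ i, w i = c₁ * g₁ i + c₂ * g₂ i)
    (hs : Differentiable ℂ s) (a b c : ℕ) (z : ℂ) :
    HasDerivAt (auxFun p g₁ g₂ w k P s a b c)
      (auxFun p g₁ g₂ w k P s (a + 1) b c z + c₁ * auxFun p g₁ g₂ w k P s a (b + 1) c z +
        c₂ * auxFun p g₁ g₂ w k P s a b (c + 1) z +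
        deriv s z * auxFun (p * k) g₁ g₂ w k P s a b c z) z := by
  have h := HasDerivAt.fun_sum (u := Finset.univ) (x := z) fun (i : ι) _ =>
    (((derivative^[a] (P i)).hasDerivAt z).const_mul (p i * g₁ i ^ b * g₂ i ^ c)).mul
      (((hasDerivAt_id z).const_mul (w i)).add ((hs z).hasDerivAt.const_mul (k i))).cexp
  refine h.congr_deriv ?_
  simp only [auxFun, Finset.mul_sum, ← Finset.sum_add_distrib]
  refine Finset.sum_congr rfl fun i _ => ?_
  simp only [Pi.mul_apply, Function.iterate_succ_apply', id, hw, Pi.add_apply]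
  ring

lemma le_analyticOrderAt_auxFun {c₁ c₂ : ℂ} (hw : ∀ i, w i = c₁ * g₁ i + c₂ * g₂ i)
    (hs : Differentiable ℂ s) {z : ℂ} {n S : ℕ} (hn : (n : ℕ∞) ≤ analyticOrderAt (deriv s) z)
    (h0 : ∀ a b c, a + b + c < S → auxFun p g₁ g₂ w k P s a b c z = 0) (t : ℕ) :
    t ≤ n + 1 → ∀ a b c, a + b + c + t ≤ S →
      (t : ℕ∞) ≤ analyticOrderAt (auxFun p g₁ g₂ w k P s a b c) z := by
  have han : ∀ (p : ι → ℂ) (a b c : ℕ), AnalyticAt ℂ (auxFun p g₁ g₂ w k P s a b c) z :=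
    fun p a b c => (differentiable_auxFun hs a b c).analyticAt z
  induction t with
  | zero => simp
  | succ t ih =>
    intro ht a b c habc
    rw [Nat.cast_succ, ← analyticOrderAt_deriv_ge_iff (han p a b c) (h0 a b c (by omega))]
    have hd : deriv (auxFun p g₁ g₂ w k P s a b c) =
        auxFun p g₁ g₂ w k P s (a + 1) b c + (fun _ => c₁) * auxFun p g₁ g₂ w k P s a (b + 1) c +
        (fun _ => c₂) * auxFun p g₁ g₂ w k P s a b (c + 1) +
        deriv s * auxFun (p * k) g₁ g₂ w k P s a b c := by
      funext z
      simpa using (hasDerivAt_auxFun hw hs a b c z).deriv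
    have hmul : ∀ {f g : ℂ → ℂ}, AnalyticAt ℂ f z → AnalyticAt ℂ g z →
        (t : ℕ∞) ≤ analyticOrderAt g z → (t : ℕ∞) ≤ analyticOrderAt (f * g) z := by
      intro f g hf hg hfg
      rw [analyticOrderAt_mul hf hg]
      exact hfg.trans le_add_self
    have hds : AnalyticAt ℂ (deriv s) z := (hs.analyticAt z).deriv
    rw [hd]
    refine (le_min ((le_min ((le_min (ih (by omega) _ _ _ (by omega)) ?_).trans
      le_analyticOrderAt_add) ?_).trans le_analyticOrderAt_add) ?_).trans le_analyticOrderAt_add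
    · exact hmul analyticAt_const (han p a (b + 1) c) (ih (by omega) _ _ _ (by omega))
    · exact hmul analyticAt_const (han p a b (c + 1)) (ih (by omega) _ _ _ (by omega))
    · rw [mul_comm]
      exact hmul (han _ _ _ _) hds ((Nat.cast_le.2 (by omega)).trans hn)

lemma norm_auxFun_le {a b c : ℕ} {z : ℂ} {A G₁ G₂ Q W : ℝ} (hG₁ : ∀ i, ‖g₁ i‖ ≤ G₁)
    (hG₂ : ∀ i, ‖g₂ i‖ ≤ G₂) (hp : ∀ i, ‖p i‖ ≤ A) (hA : 0 ≤ A) (hG₁' : 0 ≤ G₁) (hG₂' : 0 ≤ G₂)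
    (hQ : 0 ≤ Q)
    (hP : ∀ i, ‖(derivative^[a] (P i)).eval z‖ ≤ Q) (hw : ∀ i, ‖w i * z + k i * s z‖ ≤ W) :
    ‖auxFun p g₁ g₂ w k P s a b c z‖ ≤
      Fintype.card ι * (A * G₁ ^ b * G₂ ^ c * Q * Real.exp W) := by
  rw [auxFun]
  refine (norm_sum_le_of_le _ (n := fun _ => A * G₁ ^ b * G₂ ^ c * Q * Real.exp W)
    fun i _ => ?_).trans (by simp)
  rw [norm_mul, norm_mul, norm_mul, norm_mul, norm_pow, norm_pow]
  gcongr
  · exact hp i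
  · exact hG₁ i
  · exact hG₂ i
  · exact hP i
  · exact (Complex.norm_exp_le_exp_norm _).trans (Real.exp_le_exp.2 (hw i))

end AuxFun

section Baker

open Polynomial

/-- The property of `α`, `β` and `c` asserted by `exists_liouville_bound`. -/
def LiouvilleBound (α β : ℂ) (c : ℝ) : Prop :=
  ∀ {ι : Type} (s : Finset ι) (a : ι → ℤ) (e f : ι → ℕ) (D : ℕ) (x : ℝ), 0 ≤ x →
    (∀ i ∈ s, e i ≤ D) → (∀ i ∈ s, f i ≤ D) → (∑ i ∈ s, |(a i : ℝ)|) ≤ Real.exp x →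
    ∑ i ∈ s, (a i : ℂ) * α ^ e i * β ^ f i ≠ 0 →
    Real.exp (-(c * (D + x))) ≤ ‖∑ i ∈ s, (a i : ℂ) * α ^ e i * β ^ f i‖

/-- The assumptions leading to a contradiction in Baker's method: the linear form
`b₁ u + b₂ + b₃ v` is too small, where `h` bounds the logarithmic size of its coefficients and
`q` is a large parameter. -/
structure BakerHyp (u v : ℂ) (c U : ℝ) (q h : ℕ) (b₁ b₂ b₃ : ℤ) : Prop where
  norm_le : ‖u‖ + ‖v‖ + 1 ≤ U
  one_le_c : 1 ≤ c
  le_q : 10 ^ 8 * (c + U) ≤ q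
  one_le_h : 1 ≤ h
  b₁_le : |(b₁ : ℝ)| ≤ Real.exp h
  b₂_le : |(b₂ : ℝ)| ≤ Real.exp h
  b₃_le : |(b₃ : ℝ)| ≤ Real.exp h
  b₃_ne : b₃ ≠ 0
  liouville : LiouvilleBound (Complex.exp (2 * π * Complex.I * u))
    (Complex.exp (2 * π * Complex.I * v)) c
  small : ‖b₁ * u + b₂ + b₃ * v‖ ≤ Real.exp (-((q : ℝ) ^ 60 * h))

/-- The coefficient of the first logarithm after elimination. -/
def elimFst {L : ℕ} (b₁ b₃ : ℤ) (l : Fin L × Fin L × Fin L) : ℤ := b₃ * (l.1 : ℕ) - b₁ * (l.2.2 : ℕ)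

/-- The coefficient of the second logarithm after elimination. -/
def elimSnd {L : ℕ} (b₂ b₃ : ℤ) (l : Fin L × Fin L × Fin L) : ℤ :=
  b₃ * (l.2.1 : ℕ) - b₂ * (l.2.2 : ℕ)

/-- The frequency after elimination. -/
noncomputable def elimFreq {L : ℕ} (u : ℂ) (b₁ b₂ b₃ : ℤ) (l : Fin L × Fin L × Fin L) : ℂ :=
  2 * π * Complex.I * ((elimFst b₁ b₃ l * u + elimSnd b₂ b₃ l) / b₃)

/-- The error in the frequency caused by the elimination. -/
noncomputable def elimErr {L : ℕ} (u v : ℂ) (b₁ b₂ b₃ : ℤ) (l : Fin L × Fin L × Fin L) : ℂ :=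
  2 * π * Complex.I * ((l.2.2 : ℕ) * (b₁ * u + b₂ + b₃ * v) / b₃)

/-- The auxiliary function for the linear form `b₁ u + b₂ + b₃ v` and its derivatives. -/
noncomputable def bakerFun (u v : ℂ) (b₁ b₂ b₃ : ℤ) {L h : ℕ}
    (p : (Fin L × Fin L × Fin L) × Fin (h * L) → ℤ) (n a b c : ℕ) (z : ℂ) : ℂ :=
  auxFun (fun i => (p i : ℂ)) (fun i => (elimFst b₁ b₃ i.1 : ℂ)) (fun i => (elimSnd b₂ b₃ i.1 : ℂ))
    (fun i => elimFreq u b₁ b₂ b₃ i.1) (fun i => elimErr u v b₁ b₂ b₃ i.1)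
    (fun i => feldmanPoly h i.2) (flatId n) a b c z

lemma elimFreq_eq {L : ℕ} (u : ℂ) (b₁ b₂ b₃ : ℤ) (l : Fin L × Fin L × Fin L) :
    elimFreq u b₁ b₂ b₃ l = 2 * π * Complex.I * u / b₃ * elimFst b₁ b₃ l +
      2 * π * Complex.I / b₃ * elimSnd b₂ b₃ l := by
  rw [elimFreq]; ring

lemma elimFreq_add_elimErr {L : ℕ} (u v : ℂ) (b₁ b₂ : ℤ) {b₃ : ℤ} (hb : b₃ ≠ 0)
    (l : Fin L × Fin L × Fin L) :
    elimFreq u b₁ b₂ b₃ l + elimErr u v b₁ b₂ b₃ l =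
      2 * π * Complex.I * ((l.1 : ℕ) * u + (l.2.1 : ℕ) + (l.2.2 : ℕ) * v) := by
  have hb' : (b₃ : ℂ) ≠ 0 := by exact_mod_cast hb
  rw [elimFreq, elimErr, ← mul_add, ← add_div, elimFst, elimSnd]
  congr 1
  rw [div_eq_iff hb']
  push_cast; ring

lemma bakerFun_natCast (u v : ℂ) (b₁ b₂ : ℤ) {b₃ : ℤ} (hb : b₃ ≠ 0) {L h : ℕ}
    (p : (Fin L × Fin L × Fin L) × Fin (h * L) → ℤ) (n a b c r : ℕ) :
    bakerFun u v b₁ b₂ b₃ p n a b c r = ∑ i, (p i : ℂ) * ((elimFst b₁ b₃ i.1 : ℂ) ^ b *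
      (elimSnd b₂ b₃ i.1 : ℂ) ^ c * (derivative^[a] (feldmanPoly h i.2)).eval (r : ℂ) *
      (Complex.exp (2 * π * Complex.I * u) ^ ((i.1.1 : ℕ) * r) *
        Complex.exp (2 * π * Complex.I * v) ^ ((i.1.2.2 : ℕ) * r))) := by
  rw [bakerFun, auxFun]
  refine Finset.sum_congr rfl fun i _ => ?_
  have h1 : Complex.exp (elimFreq u b₁ b₂ b₃ i.1 * r + elimErr u v b₁ b₂ b₃ i.1 * flatId n r) =
      Complex.exp (2 * π * Complex.I * u) ^ ((i.1.1 : ℕ) * r) *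
        Complex.exp (2 * π * Complex.I * v) ^ ((i.1.2.2 : ℕ) * r) := by
    rw [flatId_natCast, ← add_mul, elimFreq_add_elimErr u v b₁ b₂ hb, ← Complex.exp_nat_mul,
      ← Complex.exp_nat_mul, ← Complex.exp_add, Complex.exp_eq_exp_iff_exists_int]
    refine ⟨((i.1.2.1 : ℕ) * r : ℕ), ?_⟩
    push_cast; ring
  rw [h1]; ring

lemma hundred_mul_pow_le_exp {x : ℝ} (hx : 10 ^ 8 ≤ x) : 100 * x ^ 38 ≤ Real.exp x := by
  have h1 : x / 76 ≤ Real.exp (x / 76) := by linarith [Real.add_one_le_exp (x / 76)]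
  have h2 : Real.exp x = (Real.exp (x / 76) ^ 2) ^ 38 := by
    rw [← pow_mul, ← Real.exp_nat_mul]; congr 1; push_cast; ring
  have h3 : 2 * x ≤ Real.exp (x / 76) ^ 2 := by
    have : (x / 76) ^ 2 ≤ Real.exp (x / 76) ^ 2 := by gcongr
    nlinarith
  calc 100 * x ^ 38 ≤ 2 ^ 38 * x ^ 38 := by gcongr; norm_num
    _ = (2 * x) ^ 38 := by rw [mul_pow]
    _ ≤ _ := by rw [h2]; gcongr

namespace BakerHyp

variable {u v : ℂ} {c U : ℝ} {q h : ℕ} {b₁ b₂ b₃ : ℤ}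

lemma one_le_U (H : BakerHyp u v c U q h b₁ b₂ b₃) : 1 ≤ U := by
  linarith [H.norm_le, norm_nonneg u, norm_nonneg v]

lemma le_q' (H : BakerHyp u v c U q h b₁ b₂ b₃) : (10 ^ 8 : ℝ) ≤ q := by
  linarith [H.le_q, H.one_le_U, H.one_le_c]

lemma one_le_q (H : BakerHyp u v c U q h b₁ b₂ b₃) : (1 : ℝ) ≤ q := by
  linarith [H.le_q']

lemma one_le_h' (H : BakerHyp u v c U q h b₁ b₂ b₃) : (1 : ℝ) ≤ h := by
  exact_mod_cast H.one_le_h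

/-- Comparison of exponents, losing one power of `q` to absorb a constant. -/
lemma mul_pow_le (H : BakerHyp u v c U q h b₁ b₂ b₃) {k m : ℕ} (hkm : k + 1 ≤ m) {C : ℝ}
    (hC : C ≤ q) : C * (q : ℝ) ^ k ≤ (q : ℝ) ^ m := by
  calc C * (q : ℝ) ^ k ≤ q * (q : ℝ) ^ k := by gcongr
    _ = (q : ℝ) ^ (k + 1) := by ring
    _ ≤ _ := pow_le_pow_right₀ H.one_le_q hkm

lemma card_le (H : BakerHyp u v c U q h b₁ b₂ b₃) :
    (h : ℝ) * (q : ℝ) ^ 36 ≤ Real.exp (2 * q * h) := by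
  have h1 : (h : ℝ) ≤ Real.exp h := by linarith [Real.add_one_le_exp (h : ℝ)]
  have h2 := hundred_mul_pow_le_exp H.le_q'
  have h3 : (q : ℝ) ^ 36 ≤ (q : ℝ) ^ 38 := pow_le_pow_right₀ H.one_le_q (by norm_num)
  calc (h : ℝ) * (q : ℝ) ^ 36 ≤ Real.exp h * Real.exp q := by
        gcongr
        have : (0 : ℝ) ≤ (q : ℝ) ^ 38 := by positivity
        linarith
    _ = Real.exp (h + q) := by rw [Real.exp_add]
    _ ≤ _ := by
        gcongr
        nlinarith [H.one_le_q, H.one_le_h']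

lemma norm_elim_le (H : BakerHyp u v c U q h b₁ b₂ b₃) {b : ℤ} (hb : |(b : ℝ)| ≤ Real.exp h)
    (m n : Fin (q ^ 9)) : |((b₃ * (m : ℕ) - b * (n : ℕ) : ℤ) : ℝ)| ≤ Real.exp (2 * q * h) := by
  have hm : ((m : ℕ) : ℝ) ≤ (q : ℝ) ^ 9 := by exact_mod_cast m.2.le
  have hn : ((n : ℕ) : ℝ) ≤ (q : ℝ) ^ 9 := by exact_mod_cast n.2.le
  have h2 := hundred_mul_pow_le_exp H.le_q'
  have h3 : (q : ℝ) ^ 9 ≤ (q : ℝ) ^ 38 := pow_le_pow_right₀ H.one_le_q (by norm_num)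
  push_cast
  calc _ ≤ |(b₃ : ℝ) * (m : ℕ)| + |(b : ℝ) * (n : ℕ)| := abs_sub _ _
    _ ≤ Real.exp h * (q : ℝ) ^ 9 + Real.exp h * (q : ℝ) ^ 9 := by
        rw [abs_mul, abs_mul, Nat.abs_cast, Nat.abs_cast]
        gcongr
        exact H.b₃_le
    _ ≤ Real.exp h * Real.exp q := by
        rw [← mul_add]
        gcongr
        linarith [show (0 : ℝ) ≤ (q : ℝ) ^ 9 by positivity]
    _ = Real.exp (h + q) := by rw [Real.exp_add]
    _ ≤ _ := by
        gcongr
        nlinarith [H.one_le_q, H.one_le_h']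

lemma norm_elimFst_le (H : BakerHyp u v c U q h b₁ b₂ b₃)
    (l : Fin (q ^ 9) × Fin (q ^ 9) × Fin (q ^ 9)) :
    ‖(elimFst b₁ b₃ l : ℂ)‖ ≤ Real.exp (2 * q * h) := by
  rw [Complex.norm_intCast]; exact H.norm_elim_le H.b₁_le _ _

lemma norm_elimSnd_le (H : BakerHyp u v c U q h b₁ b₂ b₃)
    (l : Fin (q ^ 9) × Fin (q ^ 9) × Fin (q ^ 9)) :
    ‖(elimSnd b₂ b₃ l : ℂ)‖ ≤ Real.exp (2 * q * h) := by
  rw [Complex.norm_intCast]; exact H.norm_elim_le H.b₂_le _ _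

lemma norm_two_pi_I : ‖(2 * π * Complex.I : ℂ)‖ ≤ 7 := by
  simp only [norm_mul, Complex.norm_I, Complex.norm_real, Complex.norm_ofNat, norm_eq_abs,
    abs_of_pos Real.pi_pos, mul_one]
  linarith [Real.pi_lt_d2]

lemma norm_elimErr_le (H : BakerHyp u v c U q h b₁ b₂ b₃)
    (l : Fin (q ^ 9) × Fin (q ^ 9) × Fin (q ^ 9)) :
    ‖elimErr u v b₁ b₂ b₃ l‖ ≤ Real.exp (-(9 * (q : ℝ) ^ 59 * h)) := by
  have h1 : (1 : ℝ) ≤ ‖(b₃ : ℂ)‖ := by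
    rw [Complex.norm_intCast]
    exact_mod_cast Int.one_le_abs H.b₃_ne
  have hm : ((l.2.2 : ℕ) : ℝ) ≤ (q : ℝ) ^ 9 := by exact_mod_cast l.2.2.2.le
  have h2 := hundred_mul_pow_le_exp H.le_q'
  have h3 : (q : ℝ) ^ 9 ≤ (q : ℝ) ^ 38 := pow_le_pow_right₀ H.one_le_q (by norm_num)
  rw [elimErr, norm_mul, norm_div, norm_mul (_ : ℂ) (b₁ * u + b₂ + b₃ * v), Complex.norm_natCast]
  calc _ ≤ 7 * (((q : ℝ) ^ 9 * Real.exp (-((q : ℝ) ^ 60 * h))) / 1) := by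
        gcongr
        · exact norm_two_pi_I
        · exact H.small
    _ ≤ Real.exp q * Real.exp (-((q : ℝ) ^ 60 * h)) := by
        rw [div_one, ← mul_assoc]
        gcongr
        linarith [show (0 : ℝ) ≤ (q : ℝ) ^ 9 by positivity]
    _ ≤ _ := by
        rw [← Real.exp_add, Real.exp_le_exp]
        have h4 : 10 * (q : ℝ) ^ 59 ≤ (q : ℝ) ^ 60 := H.mul_pow_le le_rfl (by linarith [H.le_q'])
        have h5 : 1 * (q : ℝ) ^ 1 ≤ (q : ℝ) ^ 59 := H.mul_pow_le (by norm_num) H.one_le_q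
        have h6 := mul_le_mul_of_nonneg_right h4 (by linarith [H.one_le_h'] : (0 : ℝ) ≤ h)
        nlinarith [H.one_le_h']

lemma norm_flatId_le (H : BakerHyp u v c U q h b₁ b₂ b₃) {z : ℂ}
    (hz : ‖z‖ ≤ 8 * (q : ℝ) ^ 38 * h) :
    ‖flatId (q ^ 11 - 1) z‖ ≤ Real.exp ((q : ℝ) ^ 59 * h) := by
  have hq : 2 ≤ q := by exact_mod_cast (by linarith [H.le_q'] : (2 : ℝ) ≤ q)
  have hT : 2 ≤ q ^ 11 := hq.trans (Nat.le_self_pow (by norm_num) q)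
  have hZ : (1 : ℝ) ≤ 8 * (q : ℝ) ^ 38 * h := by
    have := one_le_pow₀ H.one_le_q (n := 38)
    nlinarith [H.one_le_h']
  refine (_root_.norm_flatId_le (by omega) hZ hz).trans (Real.exp_le_exp.2 ?_)
  have hn : ((q ^ 11 - 1 : ℕ) : ℝ) ≤ (q : ℝ) ^ 11 := by
    rw [← Nat.cast_pow]; exact Nat.cast_le.2 (by omega)
  calc 9 * ((q ^ 11 - 1 : ℕ) : ℝ) * (8 * (q : ℝ) ^ 38 * h)
      ≤ 9 * (q : ℝ) ^ 11 * (8 * (q : ℝ) ^ 38 * h) := by gcongr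
    _ = (72 * (q : ℝ) ^ 49) * h := by ring
    _ ≤ _ := by
      gcongr
      exact H.mul_pow_le (by norm_num) (by linarith [H.le_q'])

lemma norm_elimErr_mul_flatId_le (H : BakerHyp u v c U q h b₁ b₂ b₃)
    (l : Fin (q ^ 9) × Fin (q ^ 9) × Fin (q ^ 9)) {z : ℂ} (hz : ‖z‖ ≤ 8 * (q : ℝ) ^ 38 * h) :
    ‖elimErr u v b₁ b₂ b₃ l * flatId (q ^ 11 - 1) z‖ ≤ Real.exp (-(8 * (q : ℝ) ^ 59 * h)) := by
  rw [norm_mul]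
  calc _ ≤ Real.exp (-(9 * (q : ℝ) ^ 59 * h)) * Real.exp ((q : ℝ) ^ 59 * h) := by
        gcongr
        · exact H.norm_elimErr_le l
        · exact H.norm_flatId_le hz
    _ = _ := by rw [← Real.exp_add]; ring_nf

lemma norm_freq_le (H : BakerHyp u v c U q h b₁ b₂ b₃)
    (l : Fin (q ^ 9) × Fin (q ^ 9) × Fin (q ^ 9)) :
    ‖2 * π * Complex.I * ((l.1 : ℕ) * u + (l.2.1 : ℕ) + (l.2.2 : ℕ) * v)‖ ≤
      7 * U * (q : ℝ) ^ 9 := by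
  have h1 : ((l.1 : ℕ) : ℝ) ≤ (q : ℝ) ^ 9 := by exact_mod_cast l.1.2.le
  have h2 : ((l.2.1 : ℕ) : ℝ) ≤ (q : ℝ) ^ 9 := by exact_mod_cast l.2.1.2.le
  have h3 : ((l.2.2 : ℕ) : ℝ) ≤ (q : ℝ) ^ 9 := by exact_mod_cast l.2.2.2.le
  rw [norm_mul]
  calc _ ≤ 7 * ((q : ℝ) ^ 9 * ‖u‖ + (q : ℝ) ^ 9 + (q : ℝ) ^ 9 * ‖v‖) := by
        gcongr
        · exact norm_two_pi_I
        · refine (norm_add₃_le).trans ?_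
          rw [norm_mul, norm_mul, Complex.norm_natCast, Complex.norm_natCast, Complex.norm_natCast]
          gcongr
    _ = 7 * (q : ℝ) ^ 9 * (‖u‖ + ‖v‖ + 1) := by ring
    _ ≤ 7 * (q : ℝ) ^ 9 * U := by gcongr; exact H.norm_le
    _ = _ := by ring

lemma norm_elimFreq_le (H : BakerHyp u v c U q h b₁ b₂ b₃)
    (l : Fin (q ^ 9) × Fin (q ^ 9) × Fin (q ^ 9)) :
    ‖elimFreq u b₁ b₂ b₃ l‖ ≤ 8 * U * (q : ℝ) ^ 9 := by
  have h1 : elimFreq u b₁ b₂ b₃ l = 2 * π * Complex.I *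
      ((l.1 : ℕ) * u + (l.2.1 : ℕ) + (l.2.2 : ℕ) * v) - elimErr u v b₁ b₂ b₃ l := by
    rw [← elimFreq_add_elimErr u v b₁ b₂ H.b₃_ne]; ring
  rw [h1]
  have h2 : ‖elimErr u v b₁ b₂ b₃ l‖ ≤ 1 := (H.norm_elimErr_le l).trans
    (Real.exp_le_one_iff.2 (by rw [neg_nonpos]; positivity))
  have h3 : 1 ≤ U * (q : ℝ) ^ 9 := one_le_mul_of_one_le_of_one_le H.one_le_U
    (one_le_pow₀ H.one_le_q)
  refine (norm_sub_le _ _).trans ?_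
  linarith [H.norm_freq_le l]

lemma factorial_le (H : BakerHyp u v c U q h b₁ b₂ b₃) {a : ℕ} (ha : a ≤ 36 * q ^ 11) :
    (a.factorial : ℝ) ≤ Real.exp (36 * (q : ℝ) ^ 12 * h) := by
  have h2 := hundred_mul_pow_le_exp H.le_q'
  have h3 : (q : ℝ) ^ 11 ≤ (q : ℝ) ^ 38 := pow_le_pow_right₀ H.one_le_q (by norm_num)
  have ha' : (a : ℝ) ≤ 36 * (q : ℝ) ^ 11 := by exact_mod_cast ha
  have h4 : (a : ℝ) ≤ Real.exp q := by
    linarith [show (0 : ℝ) ≤ (q : ℝ) ^ 11 by positivity]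
  calc (a.factorial : ℝ) ≤ (a : ℝ) ^ a := by exact_mod_cast Nat.factorial_le_pow a
    _ ≤ Real.exp q ^ a := by gcongr
    _ = Real.exp (a * q) := by rw [← Real.exp_nat_mul]
    _ ≤ _ := by
      refine Real.exp_le_exp.2 ?_
      calc (a : ℝ) * q ≤ (36 * (q : ℝ) ^ 11) * q := by gcongr
        _ = 36 * (q : ℝ) ^ 12 * 1 := by ring
        _ ≤ _ := by gcongr; exact H.one_le_h'

lemma norm_feldmanPoly_le (H : BakerHyp u v c U q h b₁ b₂ b₃) {a : ℕ} (ha : a ≤ 36 * q ^ 11)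
    (e : Fin (h * q ^ 9)) {z : ℂ} (hz : ‖z‖ ≤ 8 * (q : ℝ) ^ 38 * h) :
    ‖(derivative^[a] (feldmanPoly h e)).eval z‖ ≤ Real.exp (37 * (q : ℝ) ^ 12 * h) := by
  have h2 := hundred_mul_pow_le_exp H.le_q'
  have hq := H.le_q'
  have hz' : ‖z‖ + 1 ≤ h * Real.exp q := by
    have h3 := one_le_pow₀ H.one_le_q (n := 38)
    have h4 := mul_le_mul_of_nonneg_left h2 (by linarith [H.one_le_h'] : (0 : ℝ) ≤ h)
    nlinarith [H.one_le_h']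
  refine (norm_eval_iterate_derivative_feldmanPoly_le (L := q ^ 9) (by have := H.one_le_h; omega)
    e.2 (by linarith) hz' a).trans ?_
  calc _ ≤ Real.exp (36 * (q : ℝ) ^ 12 * h) * Real.exp ((q : ℝ) ^ 12 * h) := by
        refine mul_le_mul (H.factorial_le ha) ?_ (Real.exp_nonneg _) (Real.exp_nonneg _)
        · refine Real.exp_le_exp.2 ?_
          push_cast
          calc (h : ℝ) * (q : ℝ) ^ 9 * (q + 2) ≤ h * (q : ℝ) ^ 9 * (2 * q) := by
                gcongr; linarith
            _ = (2 * (q : ℝ) ^ 10) * h := by ring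
            _ ≤ _ := by
              gcongr
              exact H.mul_pow_le (by norm_num) (by linarith)
    _ = _ := by rw [← Real.exp_add]; ring_nf

lemma card_index : (Fintype.card ((Fin (q ^ 9) × Fin (q ^ 9) × Fin (q ^ 9)) × Fin (h * q ^ 9)) : ℝ)
    = h * (q : ℝ) ^ 36 := by
  simp only [Fintype.card_prod, Fintype.card_fin]
  push_cast; ring

lemma q_mul_h_le (H : BakerHyp u v c U q h b₁ b₂ b₃) {k : ℕ} (hk : 1 ≤ k) :
    (q : ℝ) * h ≤ (q : ℝ) ^ k * h := by
  gcongr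
  exact le_self_pow₀ H.one_le_q (by omega)

lemma exp_pow_mul_pow_le {m n : ℕ} (hmn : m + n ≤ 36 * q ^ 11) :
    Real.exp (2 * q * h) ^ m * Real.exp (2 * q * h) ^ n ≤ Real.exp (72 * (q : ℝ) ^ 12 * h) := by
  have hmn' : ((m + n : ℕ) : ℝ) ≤ 36 * (q : ℝ) ^ 11 := by exact_mod_cast hmn
  rw [← pow_add, ← Real.exp_nat_mul]
  refine Real.exp_le_exp.2 ?_
  calc _ ≤ (36 * (q : ℝ) ^ 11) * (2 * q * h) := by gcongr
    _ = _ := by ring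

/-- The norm of the coefficient of an exponential in `bakerFun`. -/
lemma norm_coeff_le (H : BakerHyp u v c U q h b₁ b₂ b₃)
    {m n a : ℕ} (hmn : a + m + n ≤ 36 * q ^ 11)
    (i : (Fin (q ^ 9) × Fin (q ^ 9) × Fin (q ^ 9)) × Fin (h * q ^ 9)) {z : ℂ}
    (hz : ‖z‖ ≤ 8 * (q : ℝ) ^ 38 * h) :
    ‖(elimFst b₁ b₃ i.1 : ℂ) ^ m * (elimSnd b₂ b₃ i.1 : ℂ) ^ n *
      (derivative^[a] (feldmanPoly h i.2)).eval z‖ ≤ Real.exp (109 * (q : ℝ) ^ 12 * h) := by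
  rw [norm_mul, norm_mul, norm_pow, norm_pow]
  calc _ ≤ Real.exp (2 * q * h) ^ m * Real.exp (2 * q * h) ^ n *
        Real.exp (37 * (q : ℝ) ^ 12 * h) := by
        gcongr
        · exact H.norm_elimFst_le _
        · exact H.norm_elimSnd_le _
        · exact H.norm_feldmanPoly_le (by omega) _ hz
    _ ≤ Real.exp (72 * (q : ℝ) ^ 12 * h) * Real.exp (37 * (q : ℝ) ^ 12 * h) := by
        gcongr
        exact exp_pow_mul_pow_le (by omega)
    _ = _ := by rw [← Real.exp_add]; ring_nf

lemma norm_bakerFun_le (H : BakerHyp u v c U q h b₁ b₂ b₃)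
    {p : (Fin (q ^ 9) × Fin (q ^ 9) × Fin (q ^ 9)) × Fin (h * q ^ 9) → ℤ}
    (hp : ∀ i, |(p i : ℝ)| ≤ Real.exp ((q : ℝ) ^ 12 * h)) {j a m n : ℕ} (hj : j ≤ 35)
    (hmn : a + m + n ≤ 36 * q ^ 11) {z : ℂ} (hz : ‖z‖ ≤ 8 * ((q : ℝ) ^ (j + 3) * h)) :
    ‖bakerFun u v b₁ b₂ b₃ p (q ^ 11 - 1) a m n z‖ ≤
      Real.exp (200 * U * (q : ℝ) ^ (j + 12) * h) := by
  have hU := H.one_le_U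
  have hz' : ‖z‖ ≤ 8 * (q : ℝ) ^ 38 * h := by
    refine hz.trans ?_
    rw [← mul_assoc]
    gcongr
    · exact H.one_le_q
    · omega
  have hW : ∀ i : (Fin (q ^ 9) × Fin (q ^ 9) × Fin (q ^ 9)) × Fin (h * q ^ 9),
      ‖elimFreq u b₁ b₂ b₃ i.1 * z + elimErr u v b₁ b₂ b₃ i.1 * flatId (q ^ 11 - 1) z‖ ≤
        64 * U * (q : ℝ) ^ (j + 12) * h + 1 := by
    intro i
    refine (norm_add_le _ _).trans (add_le_add ?_ ?_)
    · rw [norm_mul]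
      calc _ ≤ (8 * U * (q : ℝ) ^ 9) * (8 * ((q : ℝ) ^ (j + 3) * h)) := by
            gcongr
            exact H.norm_elimFreq_le _
        _ = _ := by ring
    · exact (H.norm_elimErr_mul_flatId_le _ hz').trans
        (Real.exp_le_one_iff.2 (by rw [neg_nonpos]; positivity))
  refine (norm_auxFun_le (fun i => H.norm_elimFst_le _) (fun i => H.norm_elimSnd_le _)
    (fun i => (Complex.norm_intCast _).trans_le (hp i)) (Real.exp_nonneg _) (Real.exp_nonneg _)
    (Real.exp_nonneg _) (Real.exp_nonneg _)
    (fun i => H.norm_feldmanPoly_le (a := a) (by omega) _ hz') hW).trans ?_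
  rw [card_index, mul_assoc (Real.exp ((q : ℝ) ^ 12 * h))]
  calc _ ≤ Real.exp (2 * q * h) * (Real.exp ((q : ℝ) ^ 12 * h) *
        Real.exp (72 * (q : ℝ) ^ 12 * h) * Real.exp (37 * (q : ℝ) ^ 12 * h) *
        Real.exp (64 * U * (q : ℝ) ^ (j + 12) * h + 1)) := by
        gcongr
        · exact H.card_le
        · exact exp_pow_mul_pow_le (by omega)
    _ = Real.exp (2 * (q * h) + 110 * ((q : ℝ) ^ 12 * h) + 64 * (U * ((q : ℝ) ^ (j + 12) * h)) +
        1) := by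
        rw [← Real.exp_add, ← Real.exp_add, ← Real.exp_add, ← Real.exp_add]; ring_nf
    _ ≤ _ := by
        refine Real.exp_le_exp.2 ?_
        have h1 := H.q_mul_h_le (k := j + 12) (by omega)
        have h2 : (q : ℝ) ^ 12 * h ≤ (q : ℝ) ^ (j + 12) * h := by
          gcongr
          · exact H.one_le_q
          · omega
        have h3 : 1 ≤ (q : ℝ) * h := one_le_mul_of_one_le_of_one_le H.one_le_q H.one_le_h'
        have h4 : (q : ℝ) ^ (j + 12) * h ≤ U * ((q : ℝ) ^ (j + 12) * h) :=
          le_mul_of_one_le_left (by positivity) hU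
        linarith

lemma bakerFun_eq_zero_of_norm_lt (H : BakerHyp u v c U q h b₁ b₂ b₃)
    {p : (Fin (q ^ 9) × Fin (q ^ 9) × Fin (q ^ 9)) × Fin (h * q ^ 9) → ℤ}
    (hp : ∀ i, |(p i : ℝ)| ≤ Real.exp ((q : ℝ) ^ 12 * h)) {k a m n r : ℕ} (hk : 12 ≤ k)
    (hk' : k ≤ 47) (hr : q ^ 9 * r ≤ q ^ k * h) (hmn : a + m + n ≤ 36 * q ^ 11)
    (hlt : ‖bakerFun u v b₁ b₂ b₃ p (q ^ 11 - 1) a m n r‖ <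
      Real.exp (-(600 * c * ((q : ℝ) ^ k * h)))) :
    bakerFun u v b₁ b₂ b₃ p (q ^ 11 - 1) a m n r = 0 := by
  by_contra hne
  have hc := H.one_le_c
  have hq0 : 0 < q := by exact_mod_cast (by linarith [H.one_le_q] : (0 : ℝ) < q)
  have hh0 : 0 < h := H.one_le_h
  have hrle : ‖(r : ℂ)‖ ≤ 8 * (q : ℝ) ^ 38 * h := by
    have h1 : q ^ 9 * r ≤ q ^ 9 * (q ^ 38 * h) := by
      refine hr.trans ?_
      rw [← mul_assoc, ← pow_add]
      gcongr
    have h2 : (r : ℝ) ≤ (q : ℝ) ^ 38 * h := by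
      exact_mod_cast Nat.le_of_mul_le_mul_left h1 (by positivity)
    rw [Complex.norm_natCast]
    linarith [show (0 : ℝ) ≤ (q : ℝ) ^ 38 * h by positivity]
  choose t ht using fun i : (Fin (q ^ 9) × Fin (q ^ 9) × Fin (q ^ 9)) × Fin (h * q ^ 9) =>
    hasIntegralDerivatives_feldmanPoly hh0 i.2 a r
  set d := h.lcmUpto with hd
  have hd0 : (d : ℂ) ≠ 0 := by exact_mod_cast h.lcmUpto_pos.ne'
  have hda : (d : ℝ) ^ a ≤ Real.exp (216 * ((q : ℝ) ^ 12 * h)) := by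
    have ha' : (a : ℝ) ≤ 36 * (q : ℝ) ^ 11 := by exact_mod_cast (by omega : a ≤ 36 * q ^ 11)
    calc (d : ℝ) ^ a ≤ Real.exp (6 * h) ^ a := by gcongr; exact Nat.lcmUpto_le_exp h
      _ = Real.exp (a * (6 * h)) := by rw [← Real.exp_nat_mul]
      _ ≤ _ := by
        refine Real.exp_le_exp.2 ?_
        calc (a : ℝ) * (6 * h) ≤ 36 * (q : ℝ) ^ 11 * (6 * h) := by gcongr
          _ = 216 * ((q : ℝ) ^ 11 * h) := by ring
          _ ≤ _ := by
            gcongr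
            · exact H.one_le_q
            · norm_num
  set A : (Fin (q ^ 9) × Fin (q ^ 9) × Fin (q ^ 9)) × Fin (h * q ^ 9) → ℤ := fun i =>
    p i * (elimFst b₁ b₃ i.1 ^ m * elimSnd b₂ b₃ i.1 ^ n * t i) with hA
  have hAeq : ∀ i, (A i : ℂ) = (d : ℂ) ^ a * (p i * ((elimFst b₁ b₃ i.1 : ℂ) ^ m *
      (elimSnd b₂ b₃ i.1 : ℂ) ^ n * (derivative^[a] (feldmanPoly h i.2)).eval (r : ℂ))) := by
    intro i
    rw [hA]
    push_cast
    rw [← ht]; ring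
  have hsum : ∑ i, (A i : ℂ) * Complex.exp (2 * π * Complex.I * u) ^ ((i.1.1 : ℕ) * r) *
      Complex.exp (2 * π * Complex.I * v) ^ ((i.1.2.2 : ℕ) * r) =
      (d : ℂ) ^ a * bakerFun u v b₁ b₂ b₃ p (q ^ 11 - 1) a m n r := by
    rw [bakerFun_natCast _ _ _ _ H.b₃_ne, Finset.mul_sum]
    refine Finset.sum_congr rfl fun i _ => ?_
    rw [hAeq]; ring
  have hAle : ∑ i, |(A i : ℝ)| ≤ Real.exp (328 * ((q : ℝ) ^ 12 * h)) := by
    calc _ ≤ ∑ i : (Fin (q ^ 9) × Fin (q ^ 9) × Fin (q ^ 9)) × Fin (h * q ^ 9),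
          Real.exp (216 * ((q : ℝ) ^ 12 * h)) * (Real.exp ((q : ℝ) ^ 12 * h) *
            Real.exp (109 * (q : ℝ) ^ 12 * h)) := by
          refine Finset.sum_le_sum fun i _ => ?_
          rw [← Complex.norm_intCast, hAeq, norm_mul, norm_mul, norm_pow, Complex.norm_natCast,
            Complex.norm_intCast]
          gcongr
          · exact hp i
          · exact H.norm_coeff_le hmn i hrle
      _ = (h * (q : ℝ) ^ 36) * Real.exp (326 * ((q : ℝ) ^ 12 * h)) := by
          rw [Finset.sum_const, nsmul_eq_mul, Finset.card_univ, card_index, ← Real.exp_add,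
            ← Real.exp_add]
          ring_nf
      _ ≤ Real.exp (2 * q * h) * Real.exp (326 * ((q : ℝ) ^ 12 * h)) := by
          gcongr; exact H.card_le
      _ ≤ _ := by
          rw [← Real.exp_add, Real.exp_le_exp]
          linarith [H.q_mul_h_le (k := 12) (by norm_num)]
  have hL := H.liouville Finset.univ A (fun i => (i.1.1 : ℕ) * r) (fun i => (i.1.2.2 : ℕ) * r)
    (q ^ k * h) (328 * ((q : ℝ) ^ 12 * h)) (by positivity)
    (fun i _ => (Nat.mul_le_mul_right r i.1.1.2.le).trans hr)
    (fun i _ => (Nat.mul_le_mul_right r i.1.2.2.2.le).trans hr) hAle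
    (by rw [hsum]; exact mul_ne_zero (pow_ne_zero _ hd0) hne)
  rw [hsum, norm_mul, norm_pow, Complex.norm_natCast] at hL
  have h12 : (q : ℝ) ^ 12 * h ≤ (q : ℝ) ^ k * h := by
    gcongr
    exact H.one_le_q
  have hkc : (q : ℝ) ^ k * h ≤ c * ((q : ℝ) ^ k * h) := le_mul_of_one_le_left (by positivity) hc
  have h12c : c * ((q : ℝ) ^ 12 * h) ≤ c * ((q : ℝ) ^ k * h) := by gcongr
  have : (d : ℝ) ^ a * ‖bakerFun u v b₁ b₂ b₃ p (q ^ 11 - 1) a m n r‖ <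
      Real.exp (216 * ((q : ℝ) ^ 12 * h)) * Real.exp (-(600 * c * ((q : ℝ) ^ k * h))) :=
    mul_lt_mul' hda hlt (norm_nonneg _) (Real.exp_pos _)
  refine absurd (hL.trans_lt this) (not_lt.2 ?_)
  rw [← Real.exp_add, Real.exp_le_exp]
  push_cast
  linarith [show (0 : ℝ) ≤ (q : ℝ) ^ k * h by positivity]

/-- The extrapolation step: zeros at many integers force `bakerFun` to be tiny on a large disc. -/
lemma norm_bakerFun_le_of_forall_eq_zero (H : BakerHyp u v c U q h b₁ b₂ b₃)
    {p : (Fin (q ^ 9) × Fin (q ^ 9) × Fin (q ^ 9)) × Fin (h * q ^ 9) → ℤ}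
    (hp : ∀ i, |(p i : ℝ)| ≤ Real.exp ((q : ℝ) ^ 12 * h)) {j : ℕ} (hj : j ≤ 35)
    (h0 : ∀ r ∈ Finset.Icc 1 (q ^ (j + 2) * h), ∀ a m n, a + m + n < (36 - j) * q ^ 11 →
      bakerFun u v b₁ b₂ b₃ p (q ^ 11 - 1) a m n r = 0) {a m n : ℕ}
    (hmn : a + m + n + q ^ 11 ≤ (36 - j) * q ^ 11) {z : ℂ} (hz : ‖z‖ ≤ (q : ℝ) ^ (j + 3) * h) :
    ‖bakerFun u v b₁ b₂ b₃ p (q ^ 11 - 1) a m n z‖ ≤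
      Real.exp (-((q - 200 * U) * ((q : ℝ) ^ (j + 12) * h))) := by
  have hq0 : (0 : ℝ) < q := by linarith [H.one_le_q]
  have hh0 : (0 : ℝ) < h := by linarith [H.one_le_h']
  have hT : 1 ≤ q ^ 11 := Nat.one_le_pow _ _ (by exact_mod_cast hq0)
  have hle : (36 - j) * q ^ 11 ≤ 36 * q ^ 11 := Nat.mul_le_mul_right _ (by omega)
  have hs := differentiable_flatId (q ^ 11 - 1)
  have key := norm_le_of_le_analyticOrderAt
    (F := bakerFun u v b₁ b₂ b₃ p (q ^ 11 - 1) a m n) (T := q ^ 11) (R := q ^ (j + 2) * h)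
    (ρ := (q : ℝ) ^ (j + 3) * h) (G := Real.exp (200 * U * (q : ℝ) ^ (j + 12) * h))
    (differentiable_auxFun hs a m n) (by positivity) (by
      push_cast
      gcongr
      · exact H.one_le_q
      · omega) (fun r hr => ?_)
    (fun z hz => H.norm_bakerFun_le hp hj (by omega) hz) hz
  · refine key.trans ?_
    rw [← Real.exp_add, Real.exp_le_exp]
    push_cast
    ring_nf
    exact le_refl _
  · have hw : ∀ i : (Fin (q ^ 9) × Fin (q ^ 9) × Fin (q ^ 9)) × Fin (h * q ^ 9),
        elimFreq u b₁ b₂ b₃ i.1 = 2 * π * Complex.I * u / b₃ * elimFst b₁ b₃ i.1 +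
          2 * π * Complex.I / b₃ * elimSnd b₂ b₃ i.1 := fun i => elimFreq_eq u b₁ b₂ b₃ i.1
    have hn := le_analyticOrderAt_deriv_flatId (q ^ 11 - 1) r
    unfold bakerFun at h0 ⊢
    exact le_analyticOrderAt_auxFun hw hs hn (h0 r hr) (q ^ 11) (by omega) a m n hmn

lemma bakerFun_eq_zero_succ (H : BakerHyp u v c U q h b₁ b₂ b₃)
    {p : (Fin (q ^ 9) × Fin (q ^ 9) × Fin (q ^ 9)) × Fin (h * q ^ 9) → ℤ}
    (hp : ∀ i, |(p i : ℝ)| ≤ Real.exp ((q : ℝ) ^ 12 * h)) {j : ℕ} (hj : j < 35)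
    (h0 : ∀ r ∈ Finset.Icc 1 (q ^ (j + 2) * h), ∀ a m n, a + m + n < (36 - j) * q ^ 11 →
      bakerFun u v b₁ b₂ b₃ p (q ^ 11 - 1) a m n r = 0) :
    ∀ r ∈ Finset.Icc 1 (q ^ (j + 1 + 2) * h), ∀ a m n, a + m + n < (36 - (j + 1)) * q ^ 11 →
      bakerFun u v b₁ b₂ b₃ p (q ^ 11 - 1) a m n r = 0 := by
  intro r hr a m n hmn
  rw [Finset.mem_Icc] at hr
  have hle : (36 - j) * q ^ 11 = (36 - (j + 1)) * q ^ 11 + q ^ 11 := by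
    rw [show 36 - j = 36 - (j + 1) + 1 by omega]; ring
  have hle' : (36 - j) * q ^ 11 ≤ 36 * q ^ 11 := Nat.mul_le_mul_right _ (by omega)
  refine H.bakerFun_eq_zero_of_norm_lt hp (k := j + 12) (by omega) (by omega) ?_ (by omega) ?_
  · calc q ^ 9 * r ≤ q ^ 9 * (q ^ (j + 1 + 2) * h) := Nat.mul_le_mul_left _ hr.2
      _ = _ := by ring
  · refine (H.norm_bakerFun_le_of_forall_eq_zero hp hj.le h0 (a := a) (m := m) (n := n) (by omega)
      (z := r) ?_).trans_lt ?_
    · rw [Complex.norm_natCast]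
      exact_mod_cast hr.2
    · rw [Real.exp_lt_exp, neg_lt_neg_iff]
      have : (0 : ℝ) < (q : ℝ) ^ (j + 12) * h := by
        have := H.one_le_q
        have := H.one_le_h'
        positivity
      gcongr
      linarith [H.le_q, H.one_le_U, H.one_le_c]

end BakerHyp

lemma one_le_factorial_mul_norm_leadingCoeff_sum {M h : ℕ} {p : Fin M → ℤ} (hp : p ≠ 0) :
    1 ≤ ((∑ e, C (p e : ℂ) * feldmanPoly h e).natDegree.factorial : ℝ) *
      ‖(∑ e, C (p e : ℂ) * feldmanPoly h e).leadingCoeff‖ := by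
  classical
  obtain ⟨e, he⟩ : ∃ e, p e ≠ 0 := Function.ne_iff.1 hp
  obtain ⟨d, hd, hmax⟩ := (Finset.univ.filter fun e => p e ≠ 0).exists_max_image id ⟨e, by simpa⟩
  rw [Finset.mem_filter] at hd
  have hcoeff : ∀ n : ℕ, (d : ℕ) ≤ n → (∑ e, C (p e : ℂ) * feldmanPoly h e).coeff n =
      p d * (feldmanPoly h d).coeff n := by
    intro n hn
    rw [finsetSum_coeff, Finset.sum_eq_single d]
    · rw [coeff_C_mul]
    · intro e _ hed
      rw [coeff_C_mul]
      by_cases hpe : p e = 0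
      · simp [hpe]
      · have h1 : e ≤ d := hmax e (by simpa using hpe)
        have h2 : (e : ℕ) < n := (Fin.lt_def.1 (lt_of_le_of_ne h1 hed)).trans_le hn
        rw [coeff_eq_zero_of_natDegree_lt (by rwa [natDegree_feldmanPoly]), mul_zero]
    · simp
  have hlead : (∑ e, C (p e : ℂ) * feldmanPoly h e).coeff d =
      p d * (feldmanPoly h d).leadingCoeff := by
    rw [hcoeff d le_rfl, leadingCoeff, natDegree_feldmanPoly]
  have hdeg : (∑ e, C (p e : ℂ) * feldmanPoly h e).natDegree = d := by
    refine natDegree_eq_of_le_of_coeff_ne_zero (natDegree_le_iff_coeff_eq_zero.2 fun n hn => ?_) ?_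
    · rw [hcoeff n hn.le, coeff_eq_zero_of_natDegree_lt (by rwa [natDegree_feldmanPoly]), mul_zero]
    · rw [hlead]
      exact mul_ne_zero (by exact_mod_cast hd.2) (leadingCoeff_ne_zero.2 (feldmanPoly_ne_zero _ _))
  have h1 : (1 : ℝ) ≤ ‖(p d : ℂ)‖ := by
    rw [Complex.norm_intCast]; exact_mod_cast Int.one_le_abs hd.2
  have h2 := one_le_factorial_mul_norm_leadingCoeff_feldmanPoly h d
  rw [leadingCoeff, hdeg, hlead, norm_mul, mul_left_comm]
  exact one_le_mul_of_one_le_of_one_le h1 h2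

namespace BakerHyp

variable {u v : ℂ} {c U : ℝ} {q h : ℕ} {b₁ b₂ b₃ : ℤ}

/-- Siegel's lemma and Liouville's inequality provide an auxiliary function with many zeros. -/
lemma exists_bakerFun_eq_zero (H : BakerHyp u v c U q h b₁ b₂ b₃) :
    ∃ p : (Fin (q ^ 9) × Fin (q ^ 9) × Fin (q ^ 9)) × Fin (h * q ^ 9) → ℤ, p ≠ 0 ∧
      (∀ i, |(p i : ℝ)| ≤ Real.exp ((q : ℝ) ^ 12 * h)) ∧
      ∀ r ∈ Finset.Icc 1 (q ^ 2 * h), ∀ a m n, a + m + n < 36 * q ^ 11 →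
        bakerFun u v b₁ b₂ b₃ p (q ^ 11 - 1) a m n r = 0 := by
  have hc := H.one_le_c
  have hU := H.one_le_U
  have hq1 := H.one_le_q
  have hh1 := H.one_le_h'
  have hq0 : 0 < q := by exact_mod_cast (by linarith : (0 : ℝ) < q)
  have hh0 : 0 < h := H.one_le_h
  have hqh : 1 ≤ (q : ℝ) * h := one_le_mul_of_one_le_of_one_le hq1 hh1
  have hY := H.q_mul_h_le (k := 12) (by norm_num)
  have hY0 : 0 ≤ (q : ℝ) ^ 12 * h := by positivity
  have : Nonempty (Fin (q ^ 2 * h) × Fin (36 * q ^ 11) × Fin (36 * q ^ 11) × Fin (36 * q ^ 11)) :=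
    ⟨⟨0, by positivity⟩, ⟨0, by positivity⟩, ⟨0, by positivity⟩, ⟨0, by positivity⟩⟩
  have hrow : ∀ (k : Fin (q ^ 2 * h)), (((k : ℕ) + 1 : ℕ) : ℝ) ≤ (q : ℝ) ^ 2 * h := by
    intro k
    exact_mod_cast Nat.succ_le_of_lt k.2
  have hexp : ∀ (x y : ℕ) (w : ℂ), ‖Complex.exp (2 * π * Complex.I * w) ^ (x * y)‖ ≤
      Real.exp (7 * ‖w‖ * (x * y)) := by
    intro x y w
    rw [← Complex.exp_nat_mul]
    refine (Complex.norm_exp_le_exp_norm _).trans (Real.exp_le_exp.2 ?_)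
    rw [norm_mul, norm_mul, Complex.norm_natCast]
    push_cast
    calc _ ≤ (x : ℝ) * y * (7 * ‖w‖) := by gcongr; exact norm_two_pi_I
      _ = _ := by ring
  have hcU : c * ((q : ℝ) ^ 12 * h) ≥ (q : ℝ) ^ 12 * h := le_mul_of_one_le_left hY0 hc
  have hUY : U * ((q : ℝ) ^ 12 * h) ≥ (q : ℝ) ^ 12 * h := le_mul_of_one_le_left hY0 hU
  obtain ⟨p, hp0, hp, hsmall⟩ := exists_int_vec_norm_sum_le
    (κ := Fin (q ^ 2 * h) × Fin (36 * q ^ 11) × Fin (36 * q ^ 11) × Fin (36 * q ^ 11))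
    (ι := (Fin (q ^ 9) × Fin (q ^ 9) × Fin (q ^ 9)) × Fin (h * q ^ 9))
    (fun k i => (elimFst b₁ b₃ i.1 : ℂ) ^ (k.2.2.1 : ℕ) * (elimSnd b₂ b₃ i.1 : ℂ) ^ (k.2.2.2 : ℕ) *
      (derivative^[k.2.1] (feldmanPoly h i.2)).eval (((k.1 : ℕ) + 1 : ℕ) : ℂ) *
      (Complex.exp (2 * π * Complex.I * u) ^ ((i.1.1 : ℕ) * ((k.1 : ℕ) + 1)) *
        Complex.exp (2 * π * Complex.I * v) ^ ((i.1.2.2 : ℕ) * ((k.1 : ℕ) + 1))))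
    (A := Real.exp (190 * (U * ((q : ℝ) ^ 12 * h))))
    (K := Real.exp (610 * (c * ((q : ℝ) ^ 12 * h))))
    (X := 614 * (c + U) * ((q : ℝ) ^ 12 * h)) (E := 614 * (c + U)) (Real.exp_pos _)
    (fun k i => by
      have hrk := hrow k.1
      have hz : ‖(((k.1 : ℕ) + 1 : ℕ) : ℂ)‖ ≤ 8 * (q : ℝ) ^ 38 * h := by
        rw [Complex.norm_natCast]
        calc _ ≤ (q : ℝ) ^ 2 * h := hrk
          _ ≤ (q : ℝ) ^ 38 * h := by gcongr; norm_num
          _ ≤ _ := by linarith [show (0 : ℝ) ≤ (q : ℝ) ^ 38 * h by positivity]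
      have hg : ∀ (n : Fin (36 * q ^ 11)) (g : ℂ), ‖g‖ ≤ Real.exp (2 * q * h) →
          ‖g ^ (n : ℕ)‖ ≤ Real.exp (72 * (q : ℝ) ^ 12 * h) := by
        intro n g hg
        rw [norm_pow]
        calc _ ≤ Real.exp (2 * q * h) ^ (n : ℕ) * Real.exp (2 * q * h) ^ 0 := by
              rw [pow_zero, mul_one]; gcongr
          _ ≤ _ := exp_pow_mul_pow_le n.2.le
      have hl : ∀ (l : Fin (q ^ 9)) (w : ℂ),
          ‖Complex.exp (2 * π * Complex.I * w) ^ ((l : ℕ) * ((k.1 : ℕ) + 1))‖ ≤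
            Real.exp (7 * ‖w‖ * ((q : ℝ) ^ 11 * h)) := by
        intro l w
        refine (hexp _ _ w).trans (Real.exp_le_exp.2 ?_)
        have hl : ((l : ℕ) : ℝ) ≤ (q : ℝ) ^ 9 := by exact_mod_cast l.2.le
        calc _ ≤ 7 * ‖w‖ * ((q : ℝ) ^ 9 * ((q : ℝ) ^ 2 * h)) := by gcongr
          _ = _ := by ring
      have h7 : 7 * ‖u‖ * ((q : ℝ) ^ 11 * h) + 7 * ‖v‖ * ((q : ℝ) ^ 11 * h) ≤
          U * ((q : ℝ) ^ 12 * h) := by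
        have h8 := H.mul_pow_le (k := 11) (m := 12) le_rfl (C := 7) (by linarith [H.le_q'])
        calc _ = (7 * (q : ℝ) ^ 11 * h) * (‖u‖ + ‖v‖) := by ring
          _ ≤ (q : ℝ) ^ 12 * h * U := by
            gcongr
            linarith [H.norm_le]
          _ = _ := by ring
      rw [norm_mul, norm_mul, norm_mul, norm_mul]
      calc _ ≤ Real.exp (72 * (q : ℝ) ^ 12 * h) * Real.exp (72 * (q : ℝ) ^ 12 * h) *
            Real.exp (37 * (q : ℝ) ^ 12 * h) * (Real.exp (7 * ‖u‖ * ((q : ℝ) ^ 11 * h)) *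
              Real.exp (7 * ‖v‖ * ((q : ℝ) ^ 11 * h))) := by
            gcongr
            · exact hg _ _ (H.norm_elimFst_le _)
            · exact hg _ _ (H.norm_elimSnd_le _)
            · exact H.norm_feldmanPoly_le k.2.1.2.le _ hz
            · exact hl _ _
            · exact hl _ _
        _ = Real.exp (181 * ((q : ℝ) ^ 12 * h) + (7 * ‖u‖ * ((q : ℝ) ^ 11 * h) +
              7 * ‖v‖ * ((q : ℝ) ^ 11 * h))) := by
            rw [← Real.exp_add, ← Real.exp_add, ← Real.exp_add, ← Real.exp_add]; ring_nf
        _ ≤ _ := Real.exp_le_exp.2 (by linarith))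
    (by
      rw [card_index, ← Real.exp_add]
      have h1 : Real.exp (610 * (c * ((q : ℝ) ^ 12 * h)) + 190 * (U * ((q : ℝ) ^ 12 * h))) + 1 ≤
          Real.exp (610 * (c * ((q : ℝ) ^ 12 * h)) + 190 * (U * ((q : ℝ) ^ 12 * h)) + 1) := by
        rw [Real.exp_add _ 1]
        have := Real.add_one_le_exp 1
        have := Real.one_le_exp (show 0 ≤ 610 * (c * ((q : ℝ) ^ 12 * h)) +
          190 * (U * ((q : ℝ) ^ 12 * h)) by positivity)
        nlinarith
      calc _ ≤ Real.exp (2 * q * h) * _ := mul_le_mul H.card_le h1 (by positivity) (by positivity)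
        _ ≤ _ := by
          rw [← Real.exp_add]
          refine Real.exp_le_exp.2 ?_
          linarith)
    (by positivity) (by positivity) (by
      rw [card_index]
      simp only [Fintype.card_prod, Fintype.card_fin]
      push_cast
      calc _ = (93312 * (614 * (c + U) + 1)) * ((q : ℝ) ^ 35 * h) := by ring
        _ ≤ q * ((q : ℝ) ^ 35 * h) := by
          gcongr
          linarith [H.le_q]
        _ = _ := by ring)
  have hXE : 614 * (c + U) * ((q : ℝ) ^ 12 * h) / (614 * (c + U)) = (q : ℝ) ^ 12 * h := by
    field_simp
  rw [hXE] at hp hsmall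
  refine ⟨p, hp0, hp, fun r hr a m n hmn => ?_⟩
  rw [Finset.mem_Icc] at hr
  refine H.bakerFun_eq_zero_of_norm_lt hp (k := 12) le_rfl (by norm_num) ?_ hmn.le ?_
  · calc q ^ 9 * r ≤ q ^ 9 * (q ^ 2 * h) := Nat.mul_le_mul_left _ hr.2
      _ = q ^ 11 * h := by ring
      _ ≤ _ := Nat.mul_le_mul_right _ (Nat.pow_le_pow_right hq0 (by norm_num))
  · have h1 := hsmall (⟨r - 1, by omega⟩, ⟨a, by omega⟩, ⟨m, by omega⟩, ⟨n, by omega⟩)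
    simp only [Nat.sub_add_cancel hr.1] at h1
    rw [bakerFun_natCast _ _ _ _ H.b₃_ne]
    refine h1.trans_lt ?_
    rw [card_index, div_lt_iff₀ (Real.exp_pos _), ← Real.exp_add]
    have h2 : (2 : ℝ) ≤ Real.exp 1 := by linarith [Real.add_one_le_exp 1]
    calc _ ≤ Real.exp 1 * Real.exp (2 * q * h) * Real.exp ((q : ℝ) ^ 12 * h) := by
          rw [mul_assoc 2 (_ : ℝ), ← mul_assoc]
          gcongr
          exact H.card_le
      _ < _ := by
        rw [← Real.exp_add, ← Real.exp_add, Real.exp_lt_exp]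
        linarith

end BakerHyp

lemma BakerHyp.bakerFun_eq_zero {u v : ℂ} {c U : ℝ} {q h : ℕ} {b₁ b₂ b₃ : ℤ}
    (H : BakerHyp u v c U q h b₁ b₂ b₃)
    {p : (Fin (q ^ 9) × Fin (q ^ 9) × Fin (q ^ 9)) × Fin (h * q ^ 9) → ℤ}
    (hp : ∀ i, |(p i : ℝ)| ≤ Real.exp ((q : ℝ) ^ 12 * h))
    (h0 : ∀ r ∈ Finset.Icc 1 (q ^ 2 * h), ∀ a m n, a + m + n < 36 * q ^ 11 →
      bakerFun u v b₁ b₂ b₃ p (q ^ 11 - 1) a m n r = 0) {j : ℕ} (hj : j ≤ 35) :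
    ∀ r ∈ Finset.Icc 1 (q ^ (j + 2) * h), ∀ a m n, a + m + n < (36 - j) * q ^ 11 →
      bakerFun u v b₁ b₂ b₃ p (q ^ 11 - 1) a m n r = 0 := by
  induction j with
  | zero => simpa using h0
  | succ j ih => exact H.bakerFun_eq_zero_succ hp (by omega) (ih (by omega))

/-- The limiting exponential polynomial is close to the auxiliary function. -/
lemma BakerHyp.norm_expPoly_sub_bakerFun_le {u v : ℂ} {c U : ℝ} {q h : ℕ} {b₁ b₂ b₃ : ℤ}
    (H : BakerHyp u v c U q h b₁ b₂ b₃)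
    {p : (Fin (q ^ 9) × Fin (q ^ 9) × Fin (q ^ 9)) × Fin (h * q ^ 9) → ℤ}
    (hp : ∀ i, |(p i : ℝ)| ≤ Real.exp ((q : ℝ) ^ 12 * h)) {z : ℂ}
    (hz : ‖z‖ ≤ (q : ℝ) ^ 38 * h) :
    ‖expPoly (elimFreq u b₁ b₂ b₃) (fun l => ∑ e, C (p (l, e) : ℂ) * feldmanPoly h e) z -
      bakerFun u v b₁ b₂ b₃ p (q ^ 11 - 1) 0 0 0 z‖ ≤ Real.exp (-((q : ℝ) ^ 47 * h)) := by
  have hU := H.one_le_U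
  have hh := H.one_le_h'
  have hq := H.one_le_q
  have hz' : ‖z‖ ≤ 8 * (q : ℝ) ^ 38 * h := by
    linarith [show (0 : ℝ) ≤ (q : ℝ) ^ 38 * h by positivity]
  have heq : expPoly (elimFreq u b₁ b₂ b₃) (fun l => ∑ e, C (p (l, e) : ℂ) * feldmanPoly h e) z -
      bakerFun u v b₁ b₂ b₃ p (q ^ 11 - 1) 0 0 0 z =
      ∑ i : (Fin (q ^ 9) × Fin (q ^ 9) × Fin (q ^ 9)) × Fin (h * q ^ 9), (p i : ℂ) *
        (derivative^[0] (feldmanPoly h i.2)).eval z * Complex.exp (elimFreq u b₁ b₂ b₃ i.1 * z) *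
        -(Complex.exp (elimErr u v b₁ b₂ b₃ i.1 * flatId (q ^ 11 - 1) z) - 1) := by
    have : expPoly (elimFreq u b₁ b₂ b₃) (fun l => ∑ e, C (p (l, e) : ℂ) * feldmanPoly h e) z =
        ∑ i : (Fin (q ^ 9) × Fin (q ^ 9) × Fin (q ^ 9)) × Fin (h * q ^ 9), (p i : ℂ) *
        (derivative^[0] (feldmanPoly h i.2)).eval z *
          Complex.exp (elimFreq u b₁ b₂ b₃ i.1 * z) := by
      rw [Fintype.sum_prod_type, expPoly]
      refine Finset.sum_congr rfl fun l _ => ?_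
      rw [eval_finsetSum, Finset.sum_mul]
      simp
    rw [this, bakerFun, auxFun, ← Finset.sum_sub_distrib]
    refine Finset.sum_congr rfl fun i _ => ?_
    rw [Complex.exp_add]; ring
  rw [heq]
  calc _ ≤ ∑ i : (Fin (q ^ 9) × Fin (q ^ 9) × Fin (q ^ 9)) × Fin (h * q ^ 9),
        Real.exp ((q : ℝ) ^ 12 * h) * Real.exp (37 * (q : ℝ) ^ 12 * h) *
          Real.exp (8 * U * (q : ℝ) ^ 9 * ((q : ℝ) ^ 38 * h)) *
          (2 * Real.exp (-(8 * (q : ℝ) ^ 59 * h))) := by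
        refine norm_sum_le_of_le _ fun i _ => ?_
        have herr := H.norm_elimErr_mul_flatId_le i.1 hz'
        rw [norm_mul, norm_mul, norm_mul, norm_neg, Complex.norm_intCast]
        gcongr
        · exact hp i
        · exact H.norm_feldmanPoly_le (Nat.zero_le _) _ hz'
        · refine (Complex.norm_exp_le_exp_norm _).trans (Real.exp_le_exp.2 ?_)
          rw [norm_mul]
          gcongr
          exact H.norm_elimFreq_le _
        · refine (Complex.norm_exp_sub_one_le (herr.trans
            (Real.exp_le_one_iff.2 (by rw [neg_nonpos]; positivity)))).trans ?_
          gcongr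
    _ = (h * (q : ℝ) ^ 36) * 2 * (Real.exp ((q : ℝ) ^ 12 * h) *
          Real.exp (37 * (q : ℝ) ^ 12 * h) *
          Real.exp (8 * U * (q : ℝ) ^ 9 * ((q : ℝ) ^ 38 * h)) *
          Real.exp (-(8 * (q : ℝ) ^ 59 * h))) := by
        rw [Finset.sum_const, nsmul_eq_mul, Finset.card_univ, BakerHyp.card_index]
        ring
    _ ≤ Real.exp (2 * q * h) * Real.exp 1 * (Real.exp ((q : ℝ) ^ 12 * h) *
          Real.exp (37 * (q : ℝ) ^ 12 * h) *
          Real.exp (8 * U * (q : ℝ) ^ 9 * ((q : ℝ) ^ 38 * h)) *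
          Real.exp (-(8 * (q : ℝ) ^ 59 * h))) := by
        gcongr
        · exact H.card_le
        · linarith [Real.add_one_le_exp 1]
    _ = Real.exp (2 * (q * h) + 1 + 38 * ((q : ℝ) ^ 12 * h) + 8 * U * (q : ℝ) ^ 47 * h -
          8 * ((q : ℝ) ^ 59 * h)) := by
        rw [← Real.exp_add, ← Real.exp_add, ← Real.exp_add, ← Real.exp_add, ← Real.exp_add]
        ring_nf
    _ ≤ _ := by
        refine Real.exp_le_exp.2 ?_
        have hY : 1 ≤ (q : ℝ) * h := one_le_mul_of_one_le_of_one_le hq hh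
        have h1 := H.q_mul_h_le (k := 59) (by norm_num)
        have h2 : 38 * (q : ℝ) ^ 12 * h ≤ (q : ℝ) ^ 59 * h := by
          gcongr; exact H.mul_pow_le (by norm_num) (by linarith [H.le_q'])
        have h3 : 8 * U * (q : ℝ) ^ 47 * h ≤ (q : ℝ) ^ 59 * h := by
          gcongr; exact H.mul_pow_le (by norm_num) (by linarith [H.le_q, H.one_le_c])
        have h4 : 1 * (q : ℝ) ^ 47 * h ≤ (q : ℝ) ^ 59 * h := by
          gcongr; exact H.mul_pow_le (by norm_num) hq
        linarith

lemma BakerHyp.le_norm_elimFreq_sub {u v : ℂ} {c U : ℝ} {q h : ℕ} {b₁ b₂ b₃ : ℤ}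
    (H : BakerHyp u v c U q h b₁ b₂ b₃)
    (hsep : ∀ a b d : ℤ, |a| ≤ q ^ 9 → |b| ≤ q ^ 9 → |d| ≤ q ^ 9 → (a, b, d) ≠ 0 →
      Real.exp (-(U * (q : ℝ) ^ 9)) ≤ ‖a * u + b + d * v‖)
    {l m : Fin (q ^ 9) × Fin (q ^ 9) × Fin (q ^ 9)} (hlm : l ≠ m) :
    Real.exp (-(U * (q : ℝ) ^ 9)) ≤ ‖elimFreq u b₁ b₂ b₃ l - elimFreq u b₁ b₂ b₃ m‖ := by
  have hfin : ∀ x y : Fin (q ^ 9), |((x : ℕ) : ℤ) - ((y : ℕ) : ℤ)| ≤ q ^ 9 := by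
    intro x y
    have hx : ((x : ℕ) : ℤ) < q ^ 9 := by exact_mod_cast x.2
    have hy : ((y : ℕ) : ℤ) < q ^ 9 := by exact_mod_cast y.2
    rw [abs_le]
    constructor <;> linarith [Int.natCast_nonneg (x : ℕ), Int.natCast_nonneg (y : ℕ)]
  have h1 := hsep ((l.1 : ℕ) - (m.1 : ℕ)) ((l.2.1 : ℕ) - (m.2.1 : ℕ)) ((l.2.2 : ℕ) - (m.2.2 : ℕ))
    (hfin _ _) (hfin _ _) (hfin _ _) (by
      intro h0
      simp only [Prod.mk_eq_zero, sub_eq_zero, Nat.cast_inj] at h0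
      exact hlm (Prod.ext (Fin.ext h0.1) (Prod.ext (Fin.ext h0.2.1) (Fin.ext h0.2.2))))
  set x : ℂ := (((l.1 : ℕ) - (m.1 : ℕ) : ℤ) : ℂ) * u + (((l.2.1 : ℕ) - (m.2.1 : ℕ) : ℤ) : ℂ) +
    (((l.2.2 : ℕ) - (m.2.2 : ℕ) : ℤ) : ℂ) * v with hx
  have heq : 2 * π * Complex.I * x = (elimFreq u b₁ b₂ b₃ l - elimFreq u b₁ b₂ b₃ m) +
      (elimErr u v b₁ b₂ b₃ l - elimErr u v b₁ b₂ b₃ m) := by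
    have e1 := elimFreq_add_elimErr u v b₁ b₂ H.b₃_ne l
    have e2 := elimFreq_add_elimErr u v b₁ b₂ H.b₃_ne m
    rw [hx]
    push_cast
    linear_combination e2 - e1
  have hπ : ‖(2 * π * Complex.I : ℂ)‖ = 2 * π := by simp [abs_of_pos Real.pi_pos]
  have h2 : 2 * π * ‖x‖ ≤ ‖elimFreq u b₁ b₂ b₃ l - elimFreq u b₁ b₂ b₃ m‖ +
      (Real.exp (-(9 * (q : ℝ) ^ 59 * h)) + Real.exp (-(9 * (q : ℝ) ^ 59 * h))) := by
    rw [← hπ, ← norm_mul, heq]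
    refine (norm_add_le _ _).trans ?_
    gcongr
    exact (norm_sub_le _ _).trans (add_le_add (H.norm_elimErr_le l) (H.norm_elimErr_le m))
  have h3 : Real.exp (-(9 * (q : ℝ) ^ 59 * h)) ≤ Real.exp (-(U * (q : ℝ) ^ 9)) := by
    refine Real.exp_le_exp.2 (neg_le_neg ?_)
    calc U * (q : ℝ) ^ 9 ≤ (q : ℝ) ^ 59 :=
          H.mul_pow_le (by norm_num) (by linarith [H.le_q, H.one_le_c, H.one_le_U])
      _ ≤ 9 * (q : ℝ) ^ 59 * h := by
          have := H.one_le_h'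
          have : (0 : ℝ) ≤ (q : ℝ) ^ 59 := by positivity
          nlinarith
  have h4 := mul_le_mul_of_nonneg_right (by linarith [Real.pi_gt_three] : 3 ≤ 2 * π)
    (norm_nonneg x)
  linarith

lemma not_bakerHyp {u v : ℂ} {c U : ℝ} {q h : ℕ} {b₁ b₂ b₃ : ℤ}
    (hsep : ∀ a b d : ℤ, |a| ≤ q ^ 9 → |b| ≤ q ^ 9 → |d| ≤ q ^ 9 → (a, b, d) ≠ 0 →
      Real.exp (-(U * (q : ℝ) ^ 9)) ≤ ‖a * u + b + d * v‖) :
    ¬ BakerHyp u v c U q h b₁ b₂ b₃ := by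
  intro H
  classical
  have hU := H.one_le_U
  have hh := H.one_le_h'
  have hq := H.one_le_q
  have hq' := H.le_q'
  have hqU := H.le_q
  have hc := H.one_le_c
  obtain ⟨p, hp0, hp, h0⟩ := H.exists_bakerFun_eq_zero
  obtain ⟨⟨l, e⟩, hle⟩ := Function.ne_iff.1 hp0
  have hY : (0 : ℝ) ≤ (q : ℝ) ^ 45 * h := by positivity
  have hsmall : ∀ z : ℂ, ‖z‖ ≤ (q : ℝ) ^ 38 * h → ‖expPoly (elimFreq u b₁ b₂ b₃)
      (fun l => ∑ e, C (p (l, e) : ℂ) * feldmanPoly h e) z‖ ≤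
      2 * Real.exp (-((q : ℝ) ^ 47 * h)) := by
    intro z hz
    have h1 := H.norm_expPoly_sub_bakerFun_le hp hz
    have h2 := H.norm_bakerFun_le_of_forall_eq_zero hp le_rfl (H.bakerFun_eq_zero hp h0 le_rfl)
      (a := 0) (m := 0) (n := 0) (by omega) hz
    have h3 : Real.exp (-((q - 200 * U) * ((q : ℝ) ^ (35 + 12) * h))) ≤
        Real.exp (-((q : ℝ) ^ 47 * h)) := by
      refine Real.exp_le_exp.2 (neg_le_neg ?_)
      exact le_mul_of_one_le_left (by positivity) (by linarith)
    have := norm_le_norm_sub_add (expPoly (elimFreq u b₁ b₂ b₃)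
      (fun l => ∑ e, C (p (l, e) : ℂ) * feldmanPoly h e) z)
      (bakerFun u v b₁ b₂ b₃ p (q ^ 11 - 1) 0 0 0 z)
    linarith
  have hcoeff := norm_factorial_mul_coeff_le (Real.exp_pos (-(U * (q : ℝ) ^ 9)))
    (Real.exp_le_one_iff.2 (by rw [neg_nonpos]; positivity))
    (fun l => H.norm_elimFreq_le l) (fun l m hlm => H.le_norm_elimFreq_sub hsep hlm)
    (N := h * q ^ 9) (P := fun l => ∑ e, C (p (l, e) : ℂ) * feldmanPoly h e)
    (fun l => by
      refine (degree_sum_le _ _).trans_lt ((Finset.sup_lt_iff (WithBot.bot_lt_coe _)).2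
        fun e _ => ?_)
      refine (degree_le_natDegree.trans (Nat.cast_le.2 (natDegree_C_mul_le _ _))).trans_lt ?_
      rw [natDegree_feldmanPoly]
      exact_mod_cast e.2) (ρ := (q : ℝ) ^ 38 * h) (by
        simp only [Fintype.card_prod, Fintype.card_fin]
        push_cast
        calc _ = (q : ℝ) ^ 36 * h := by ring
          _ ≤ _ := by gcongr; norm_num) hsmall l
  have hlead : (1 : ℝ) ≤ _ := one_le_factorial_mul_norm_leadingCoeff_sum (h := h)
    (p := fun e => p (l, e)) (Function.ne_iff.2 ⟨e, hle⟩)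
  refine absurd (hlead.trans hcoeff) (not_le.2 ?_)
  have hratio : (1 + 8 * U * (q : ℝ) ^ 9) / Real.exp (-(U * (q : ℝ) ^ 9)) ≤
      Real.exp (2 * U * (q : ℝ) ^ 9) := by
    rw [div_le_iff₀ (Real.exp_pos _), ← Real.exp_add]
    have h1 := Real.quadratic_le_exp_of_nonneg (show 0 ≤ U * (q : ℝ) ^ 9 by positivity)
    have h2 : (q : ℝ) ≤ (q : ℝ) ^ 9 := le_self_pow₀ hq (by norm_num)
    have h3 : (16 : ℝ) ≤ U * (q : ℝ) ^ 9 := by nlinarith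
    calc _ ≤ Real.exp (U * (q : ℝ) ^ 9) := by nlinarith
      _ = _ := by ring_nf
  simp only [Fintype.card_prod, Fintype.card_fin]
  calc _ ≤ 2 * Real.exp (-((q : ℝ) ^ 47 * h)) *
        Real.exp (2 * U * (q : ℝ) ^ 9) ^ (h * q ^ 9 * (q ^ 9 * (q ^ 9 * q ^ 9))) := by
        gcongr
    _ ≤ Real.exp 1 * Real.exp (-((q : ℝ) ^ 47 * h)) *
        Real.exp (2 * U * (q : ℝ) ^ 9) ^ (h * q ^ 9 * (q ^ 9 * (q ^ 9 * q ^ 9))) := by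
        gcongr
        linarith [Real.add_one_le_exp 1]
    _ = Real.exp (1 - (q : ℝ) ^ 2 * ((q : ℝ) ^ 45 * h) + 2 * U * ((q : ℝ) ^ 45 * h)) := by
        rw [← Real.exp_nat_mul, ← Real.exp_add, ← Real.exp_add]
        push_cast
        ring_nf
    _ < 1 := by
        rw [Real.exp_lt_one_iff]
        have h1 : 1 ≤ (q : ℝ) ^ 45 * h := one_le_mul_of_one_le_of_one_le (one_le_pow₀ hq) hh
        have h2 : 2 * U + 2 ≤ (q : ℝ) ^ 2 := by nlinarith
        nlinarith

lemma LiouvilleBound.exists_exp_le_norm {u v : ℂ} {c : ℝ} (hc : 1 ≤ c)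
    (hind : ∀ a b d : ℤ, (a * u + b + d * v : ℂ) = 0 → a = 0 ∧ b = 0 ∧ d = 0)
    (hL : LiouvilleBound (Complex.exp (2 * π * Complex.I * u))
      (Complex.exp (2 * π * Complex.I * v)) c) :
    ∃ C : ℝ, 0 < C ∧ ∀ (L : ℕ) (a b d : ℤ), 1 ≤ L → |a| ≤ L → |d| ≤ L → (a, b, d) ≠ 0 →
      Real.exp (-(C * L)) ≤ ‖(a * u + b + d * v : ℂ)‖ := by
  refine ⟨2 * c + 7 * (‖u‖ + ‖v‖) + 14, by positivity, fun L a b d hL1 ha hd hne => ?_⟩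
  have hL1' : (1 : ℝ) ≤ L := by exact_mod_cast hL1
  rw [abs_le] at ha hd
  set x : ℂ := a * u + b + d * v with hx
  have hx0 : x ≠ 0 := fun h => hne (by obtain ⟨rfl, rfl, rfl⟩ := hind a b d h; rfl)
  have h14 : (15 : ℝ) ≤ Real.exp 14 := by linarith [Real.add_one_le_exp (14 : ℝ)]
  have hexp : Real.exp (-((2 * c + 7 * (‖u‖ + ‖v‖) + 14) * L)) ≤ (Real.exp 14)⁻¹ *
      Real.exp (-(c * (L + 1)) - 7 * (‖u‖ + ‖v‖) * L) := by
    rw [← Real.exp_neg, ← Real.exp_add, Real.exp_le_exp]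
    nlinarith [norm_nonneg u, norm_nonneg v]
  have hexp' : Real.exp (-((2 * c + 7 * (‖u‖ + ‖v‖) + 14) * L)) ≤ 1 / 15 := by
    refine hexp.trans ?_
    rw [one_div, ← mul_one (15⁻¹ : ℝ)]
    gcongr
    rw [Real.exp_le_one_iff]
    nlinarith [norm_nonneg u, norm_nonneg v, mul_nonneg (norm_nonneg u) (zero_le_one.trans hL1'),
      mul_nonneg (norm_nonneg v) (zero_le_one.trans hL1')]
  by_cases hsmall : ‖2 * π * Complex.I * x‖ ≤ 1
  swap
  · have := BakerHyp.norm_two_pi_I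
    rw [norm_mul] at hsmall
    nlinarith [norm_nonneg x]
  by_cases hexp_one : Complex.exp (2 * π * Complex.I * x) = 1
  · obtain ⟨n, hn⟩ := Complex.exp_eq_one_iff.1 hexp_one
    have hxn : x = n := by
      have h2 : (2 * π * Complex.I : ℂ) ≠ 0 := Complex.two_pi_I_ne_zero
      apply mul_left_cancel₀ h2
      rw [hn]; ring
    have hn0 : n ≠ 0 := by rintro rfl; simp [hxn] at hx0
    have : (1 : ℝ) ≤ ‖x‖ := by
      rw [hxn, Complex.norm_intCast]
      exact_mod_cast Int.one_le_abs hn0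
    linarith
  set α := Complex.exp (2 * π * Complex.I * u) with hα
  set β := Complex.exp (2 * π * Complex.I * v) with hβ
  have hfac : α ^ a.toNat * β ^ d.toNat - α ^ (-a).toNat * β ^ (-d).toNat =
      α ^ (-a).toNat * β ^ (-d).toNat * (Complex.exp (2 * π * Complex.I * x) - 1) := by
    have ha' : ((a.toNat : ℤ) : ℂ) = ((-a).toNat : ℤ) + a := by
      rw [← Int.cast_add]; congr 1; lia
    have hd' : ((d.toNat : ℤ) : ℂ) = ((-d).toNat : ℤ) + d := by
      rw [← Int.cast_add]; congr 1; lia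
    rw [Int.cast_natCast, Int.cast_natCast] at ha' hd'
    rw [mul_sub, mul_one, sub_left_inj, hα, hβ, ← Complex.exp_nat_mul, ← Complex.exp_nat_mul,
      ← Complex.exp_nat_mul, ← Complex.exp_nat_mul, ← Complex.exp_add, ← Complex.exp_add,
      ← Complex.exp_add, ha', hd', Complex.exp_eq_exp_iff_exists_int]
    exact ⟨-b, by rw [hx]; push_cast; ring⟩
  have hne' : α ^ (-a).toNat * β ^ (-d).toNat * (Complex.exp (2 * π * Complex.I * x) - 1) ≠ 0 := by
    refine mul_ne_zero (mul_ne_zero ?_ ?_) (sub_ne_zero.2 hexp_one) <;>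
      exact pow_ne_zero _ (Complex.exp_ne_zero _)
  have hlow := hL (Finset.univ : Finset (Fin 2)) ![1, -1] ![a.toNat, (-a).toNat]
    ![d.toNat, (-d).toNat] L 1 zero_le_one (fun i _ => by fin_cases i <;> simp <;> lia)
    (fun i _ => by fin_cases i <;> simp <;> lia)
    (by simp [Fin.sum_univ_two]; linarith [Real.add_one_le_exp (1 : ℝ)])
  have hsum : ∑ i, ((![1, -1] : Fin 2 → ℤ) i : ℂ) * α ^ (![a.toNat, (-a).toNat] : Fin 2 → ℕ) i *
      β ^ (![d.toNat, (-d).toNat] : Fin 2 → ℕ) i =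
      α ^ (-a).toNat * β ^ (-d).toNat * (Complex.exp (2 * π * Complex.I * x) - 1) := by
    rw [← hfac]
    simp [Fin.sum_univ_two]
    ring
  rw [hsum] at hlow
  replace hlow := hlow hne'
  have hpow : ∀ (w : ℂ) {k : ℕ}, k ≤ L →
      ‖Complex.exp (2 * π * Complex.I * w) ^ k‖ ≤ Real.exp (7 * ‖w‖ * L) := fun w k hk => by
    rw [← Complex.exp_nat_mul]
    refine (Complex.norm_exp_le_exp_norm _).trans (Real.exp_le_exp.2 ?_)
    rw [norm_mul, norm_mul, Complex.norm_natCast, mul_comm]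
    gcongr
    exact BakerHyp.norm_two_pi_I
  have hup : ‖α ^ (-a).toNat * β ^ (-d).toNat * (Complex.exp (2 * π * Complex.I * x) - 1)‖ ≤
      Real.exp (7 * (‖u‖ + ‖v‖) * L) * (15 * ‖x‖) := by
    rw [norm_mul, norm_mul, mul_add 7, add_mul, Real.exp_add]
    gcongr
    · exact hpow u (by lia)
    · exact hpow v (by lia)
    · refine (Complex.norm_exp_sub_one_le hsmall).trans ?_
      rw [norm_mul]
      nlinarith [BakerHyp.norm_two_pi_I, norm_nonneg x]
  refine hexp.trans ?_
  rw [sub_eq_add_neg, Real.exp_add, Real.exp_neg (7 * _ * _),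
    inv_mul_le_iff₀ (Real.exp_pos _), ← div_eq_mul_inv, div_le_iff₀ (Real.exp_pos _)]
  calc _ ≤ _ := hlow.trans hup
    _ = 15 * ‖x‖ * Real.exp (7 * (‖u‖ + ‖v‖) * L) := by ring
    _ ≤ _ := by gcongr

/-- **Baker's theorem** for three logarithms, one of which is `2 * π * I`. -/
theorem exists_exp_le_norm_linear_form {u v : ℂ}
    (hu : IsAlgebraic ℚ (Complex.exp (2 * π * Complex.I * u)))
    (hv : IsAlgebraic ℚ (Complex.exp (2 * π * Complex.I * v)))
    (hind : ∀ a b d : ℤ, (a * u + b + d * v : ℂ) = 0 → a = 0 ∧ b = 0 ∧ d = 0) :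
    ∃ C : ℝ, 0 < C ∧ ∀ (h : ℕ) (b₁ b₂ b₃ : ℤ), 1 ≤ h → b₃ ≠ 0 → |(b₁ : ℝ)| ≤ Real.exp h →
      |(b₂ : ℝ)| ≤ Real.exp h → |(b₃ : ℝ)| ≤ Real.exp h →
      Real.exp (-(C * h)) ≤ ‖(b₁ * u + b₂ + b₃ * v : ℂ)‖ := by
  obtain ⟨c, hc, hL⟩ := exists_liouville_bound hu hv
  obtain ⟨C, hC, hsep⟩ := LiouvilleBound.exists_exp_le_norm hc hind hL
  set U := ‖u‖ + ‖v‖ + 1 + C with hU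
  obtain ⟨q, hq⟩ := exists_nat_ge (10 ^ 8 * (c + U))
  have hU1 : 1 ≤ U := by rw [hU]; linarith [norm_nonneg u, norm_nonneg v]
  have hq1 : 1 ≤ q := by
    have : (1 : ℝ) ≤ q := by linarith
    exact_mod_cast this
  refine ⟨(q : ℝ) ^ 60, by positivity, fun h b₁ b₂ b₃ hh hb₃ h₁ h₂ h₃ => ?_⟩
  by_contra! hlt
  refine not_bakerHyp (fun a b d ha _ hd hne => ?_) (BakerHyp.mk (U := U) (by linarith) hc hq hh
    h₁ h₂ h₃ hb₃ hL hlt.le)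
  refine le_trans (Real.exp_le_exp.2 ?_) (hsep (q ^ 9) a b d (Nat.one_le_pow _ _ hq1)
    (by exact_mod_cast ha) (by exact_mod_cast hd) hne)
  push_cast
  gcongr
  rw [hU]
  linarith [norm_nonneg u, norm_nonneg v]

end Baker

lemma exists_rpow_neg_le {D : ℝ} (hD : 0 < D) : ∃ C : ℝ, 0 < C ∧ ∀ N : ℝ, 2 ≤ N → N ^ (-C) ≤ D := by
  obtain ⟨k, hk⟩ := exists_pow_lt_of_lt_one hD (show (1 / 2 : ℝ) < 1 by norm_num)
  refine ⟨k + 1, by positivity, fun N hN => le_trans ?_ hk.le⟩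
  rw [Real.rpow_neg (by linarith), one_div, inv_pow]
  gcongr
  calc (2 : ℝ) ^ k ≤ N ^ k := by gcongr
    _ = N ^ (k : ℝ) := (Real.rpow_natCast _ _).symm
    _ ≤ _ := by gcongr <;> linarith

lemma exists_rpow_neg_le_norm_linear_form {u v : ℂ}
    (hu : IsAlgebraic ℚ (Complex.exp (2 * π * Complex.I * u)))
    (hv : IsAlgebraic ℚ (Complex.exp (2 * π * Complex.I * v)))
    (hind : ∀ a b d : ℤ, (a * u + b + d * v : ℂ) = 0 → a = 0 ∧ b = 0 ∧ d = 0)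
    {K : ℝ} (hK : 1 ≤ K) :
    ∃ C : ℝ, 0 < C ∧ ∀ (N : ℝ) (b₁ b₂ b₃ : ℤ), 2 ≤ N → b₃ ≠ 0 → |(b₁ : ℝ)| ≤ K * N →
      |(b₂ : ℝ)| ≤ K * N → |(b₃ : ℝ)| ≤ K * N → N ^ (-C) ≤ ‖(b₁ * u + b₂ + b₃ * v : ℂ)‖ := by
  obtain ⟨C, hC, h⟩ := exists_exp_le_norm_linear_form hu hv hind
  obtain ⟨E, hE, hE'⟩ := exists_rpow_neg_le (Real.exp_pos (-(C * (Real.log K + 1))))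
  refine ⟨C + E, by positivity, fun N b₁ b₂ b₃ hN hb₃ h₁ h₂ h₃ => ?_⟩
  have hKN : 0 < Real.log (K * N) := Real.log_pos (by nlinarith)
  have hle : K * N ≤ Real.exp ⌈Real.log (K * N)⌉₊ := by
    rw [← Real.log_le_iff_le_exp (by nlinarith)]
    exact Nat.le_ceil _
  refine le_trans ?_ (h ⌈Real.log (K * N)⌉₊ b₁ b₂ b₃ (Nat.ceil_pos.2 hKN) hb₃ (h₁.trans hle)
    (h₂.trans hle) (h₃.trans hle))
  calc N ^ (-(C + E)) = N ^ (-C) * N ^ (-E) := by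
        rw [neg_add, Real.rpow_add (by linarith)]
    _ ≤ N ^ (-C) * Real.exp (-(C * (Real.log K + 1))) := by
        gcongr
        exact hE' N hN
    _ = Real.exp (-(C * (Real.log (K * N) + 1))) := by
        rw [Real.rpow_def_of_pos (by linarith), ← Real.exp_add,
          Real.log_mul (by linarith) (by linarith)]
        ring_nf
    _ ≤ _ := by
        gcongr
        exact (Nat.ceil_lt_add_one hKN.le).le

lemma exists_le_abs_add_intCast (y : ℝ) :
    ∃ ε : ℝ, 0 < ε ∧ ∀ k : ℤ, y + k ≠ 0 → ε ≤ |y + k| := by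
  by_cases hy : y = round y
  · refine ⟨1, one_pos, fun k hk => ?_⟩
    rw [hy] at hk ⊢
    have hk' : round y + k ≠ 0 := by exact_mod_cast hk
    exact_mod_cast Int.one_le_abs hk'
  · refine ⟨|y - round y|, abs_pos.2 (sub_ne_zero.2 hy), fun k _ => ?_⟩
    simpa using round_le y (-k)

lemma isAlgebraic_exp_log_two : IsAlgebraic ℚ
    (Complex.exp (2 * π * Complex.I * (-(Real.log 2 / (2 * π) : ℝ) * Complex.I))) := by
  have : (2 * π * Complex.I * (-(Real.log 2 / (2 * π) : ℝ) * Complex.I) : ℂ) = Real.log 2 := by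
    have hπ : (π : ℂ) ≠ 0 := by exact_mod_cast Real.pi_ne_zero
    push_cast
    field_simp
    rw [Complex.I_sq]
    ring
  rw [this, ← Complex.ofReal_exp, Real.exp_log two_pos]
  exact_mod_cast isAlgebraic_natCast (R := ℚ) (A := ℂ) 2

lemma exists_rpow_neg_le_abs_of_irrational {τ : ℝ} (hτ : Irrational τ)
    (halg : IsAlgebraic ℚ (Complex.exp (2 * π * Complex.I * τ))) {K : ℝ} (hK : 1 ≤ K) :
    ∃ C : ℝ, 0 < C ∧ ∀ (N : ℝ) (b d : ℤ), 2 ≤ N → d ≠ 0 → |(b : ℝ)| ≤ K * N → |(d : ℝ)| ≤ K * N →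
      N ^ (-C) ≤ |b + d * τ| := by
  obtain ⟨C, hC, h⟩ := exists_rpow_neg_le_norm_linear_form isAlgebraic_exp_log_two halg
    (by
      intro a b d h
      have hne : Real.log 2 / (2 * π) ≠ 0 := (by positivity : 0 < Real.log 2 / (2 * π)).ne'
      generalize Real.log 2 / (2 * π) = y at h hne
      have him := congrArg Complex.im h
      have hre := congrArg Complex.re h
      have ha : a = 0 := by simpa [hne] using him
      have hre' : b + d * τ = 0 := by simpa [ha] using hre
      have hd : d = 0 := by
        by_contra hd
        exact ((hτ.intCast_mul hd).intCast_add b).ne_zero hre'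
      exact ⟨ha, by simpa [hd] using hre', hd⟩) hK
  refine ⟨C, hC, fun N b d hN hd hb hd' => ?_⟩
  have := h N 0 b d hN hd (by simp; positivity) hb hd'
  rw [Int.cast_zero, zero_mul, zero_add] at this
  rw [← Real.norm_eq_abs, ← Complex.norm_real]
  exact_mod_cast this

lemma exists_rpow_neg_le_abs_of_add_eq_zero {τ σ : ℝ}
    (halg : IsAlgebraic ℚ (Complex.exp (2 * π * Complex.I * τ)))
    {a b d : ℤ} (hne : (a, b, d) ≠ 0) (hrel : a * τ + b + d * σ = 0) :
    ∃ C : ℝ, 0 < C ∧ ∀ n m : ℤ, |σ + n * τ - m| ≤ 1 → σ + n * τ - m ≠ 0 →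
      (|(n : ℝ)| + 2) ^ (-C) ≤ |σ + n * τ - m| := by
  by_cases hτ : Irrational τ
  · have hd : d ≠ 0 := by
      rintro rfl
      have hrel' : b + a * τ = 0 := by linear_combination hrel
      have ha : a = 0 := by
        by_contra ha
        exact ((hτ.intCast_mul ha).intCast_add b).ne_zero hrel'
      have hb : b = 0 := by simpa [ha] using hrel'
      exact hne (by rw [ha, hb]; rfl)
    have hd' : 1 ≤ |(d : ℝ)| := by exact_mod_cast Int.one_le_abs hd
    set K : ℝ := |(a : ℝ)| + |(b : ℝ)| + |(d : ℝ)| * (1 + |σ| + |τ|) with hK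
    have hK1 : 1 ≤ K := by
      rw [hK]
      nlinarith [abs_nonneg (a : ℝ), abs_nonneg (b : ℝ), abs_nonneg σ, abs_nonneg τ]
    obtain ⟨C, hC, h⟩ := exists_rpow_neg_le_abs_of_irrational hτ halg hK1
    obtain ⟨E, hE, hE'⟩ := exists_rpow_neg_le (show 0 < |(d : ℝ)|⁻¹ by positivity)
    refine ⟨C + E, by positivity, fun n m hsmall hx => ?_⟩
    set N : ℝ := |(n : ℝ)| + 2 with hN
    have hN2 : 2 ≤ N := by rw [hN]; linarith [abs_nonneg (n : ℝ)]
    have hmul : d * (σ + n * τ - m) = (-(b + d * m) : ℤ) + (d * n - a : ℤ) * τ := by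
      push_cast
      linear_combination hrel
    have hNC : N ^ (-C) ≤ 1 := Real.rpow_le_one_of_one_le_of_nonpos (by linarith) (by linarith)
    have hkey : N ^ (-C) ≤ |d * (σ + n * τ - m)| := by
      by_cases hn : d * n - a = 0
      · rw [hn, Int.cast_zero, zero_mul, add_zero] at hmul
        rw [hmul]
        refine hNC.trans ?_
        have : (-(b + d * m) : ℤ) ≠ 0 := fun h0 => by
          rw [h0, Int.cast_zero] at hmul
          exact mul_ne_zero (Int.cast_ne_zero.2 hd) hx hmul
        exact_mod_cast Int.one_le_abs this
      · have hm : |(m : ℝ)| ≤ 1 + |σ| + |(n : ℝ)| * |τ| := by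
          calc |(m : ℝ)| = |σ + n * τ - (σ + n * τ - m)| := by congr 1; ring
            _ ≤ |σ| + |n * τ| + |σ + n * τ - m| :=
              (abs_sub _ _).trans (by gcongr; exact abs_add_le _ _)
            _ ≤ _ := by rw [abs_mul]; linarith
        rw [hmul]
        refine h N _ _ hN2 hn ?_ ?_
        · push_cast
          rw [abs_neg]
          calc |(b : ℝ) + d * m| ≤ |(b : ℝ)| + |(d : ℝ)| * (1 + |σ| + |(n : ℝ)| * |τ|) := by
                refine (abs_add_le _ _).trans ?_
                rw [abs_mul]
                gcongr
            _ ≤ |(b : ℝ)| * N + |(d : ℝ)| * ((1 + |σ|) * N + N * |τ|) := by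
                gcongr
                · exact le_mul_of_one_le_right (abs_nonneg _) (by linarith)
                · exact le_mul_of_one_le_right (by positivity) (by linarith)
                · linarith
            _ ≤ |(a : ℝ)| * N + (|(b : ℝ)| * N + |(d : ℝ)| * ((1 + |σ|) * N + N * |τ|)) :=
                le_add_of_nonneg_left (by positivity)
            _ = K * N := by ring
        · push_cast
          calc |(d : ℝ) * n - a| ≤ |(d : ℝ)| * |(n : ℝ)| + |(a : ℝ)| := by
                rw [← abs_mul]; exact abs_sub _ _
            _ ≤ |(d : ℝ)| * N + |(a : ℝ)| * N := by
                gcongr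
                · linarith
                · exact le_mul_of_one_le_right (abs_nonneg _) (by linarith)
            _ ≤ |(d : ℝ)| * N + |(a : ℝ)| * N +
                  (|(b : ℝ)| * N + |(d : ℝ)| * (|σ| + |τ|) * N) :=
                le_add_of_nonneg_right (by positivity)
            _ = K * N := by ring
    calc N ^ (-(C + E)) = N ^ (-C) * N ^ (-E) := by
          rw [neg_add, Real.rpow_add (by linarith)]
      _ ≤ |d * (σ + n * τ - m)| * |(d : ℝ)|⁻¹ := by
          gcongr
          exact hE' N hN2
      _ = _ := by
          rw [abs_mul]
          field_simp
  · obtain ⟨r, rfl⟩ := not_not.1 hτ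
    have hr : (0 : ℝ) < r.den := by exact_mod_cast r.den_pos
    obtain ⟨ε, hε, h⟩ := exists_le_abs_add_intCast (r.den * σ)
    obtain ⟨E, hE, hE'⟩ := exists_rpow_neg_le (show 0 < ε / r.den by positivity)
    refine ⟨E, hE, fun n m _ hx => (hE' _ (by linarith [abs_nonneg (n : ℝ)])).trans ?_⟩
    have hmul : r.den * σ + (n * r.num - r.den * m : ℤ) = r.den * (σ + n * r - m) := by
      have : (r : ℝ) * r.den = r.num := by exact_mod_cast Rat.mul_den_eq_num r
      push_cast
      linear_combination (-n : ℝ) * this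
    have := h (n * r.num - r.den * m) (by rw [hmul]; exact mul_ne_zero hr.ne' hx)
    rw [hmul, abs_mul, abs_of_pos hr] at this
    rwa [div_le_iff₀' hr]

lemma exists_rpow_neg_le_abs_add_mul_sub {τ σ : ℝ}
    (hτ : IsAlgebraic ℚ (Complex.exp (2 * π * Complex.I * τ)))
    (hσ : IsAlgebraic ℚ (Complex.exp (2 * π * Complex.I * σ))) :
    ∃ C : ℝ, 0 < C ∧ ∀ n m : ℤ, |σ + n * τ - m| ≤ 1 → σ + n * τ - m ≠ 0 →
      (|(n : ℝ)| + 2) ^ (-C) ≤ |σ + n * τ - m| := by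
  by_cases hind : ∀ a b d : ℤ, a * τ + b + d * σ = 0 → (a, b, d) = 0
  swap
  · push Not at hind
    obtain ⟨a, b, d, hrel, hne⟩ := hind
    exact exists_rpow_neg_le_abs_of_add_eq_zero hτ hne hrel
  obtain ⟨C, hC, h⟩ := exists_rpow_neg_le_norm_linear_form hτ hσ (fun a b d h => by
    simpa using hind a b d (by exact_mod_cast h)) (K := 1 + |σ| + |τ|)
    (by linarith [abs_nonneg σ, abs_nonneg τ])
  refine ⟨C, hC, fun n m hsmall _ => ?_⟩
  set N : ℝ := |(n : ℝ)| + 2 with hN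
  have hN2 : 2 ≤ N := by rw [hN]; linarith [abs_nonneg (n : ℝ)]
  have hm : |(m : ℝ)| ≤ 1 + |σ| + |(n : ℝ)| * |τ| := by
    calc |(m : ℝ)| = |σ + n * τ - (σ + n * τ - m)| := by congr 1; ring
      _ ≤ |σ| + |n * τ| + |σ + n * τ - m| :=
        (abs_sub _ _).trans (by gcongr; exact abs_add_le _ _)
      _ ≤ _ := by rw [abs_mul]; linarith
  have hnN : |(n : ℝ)| ≤ N := by linarith
  have := h N n (-m) 1 hN2 one_ne_zero
    (hnN.trans (le_mul_of_one_le_left (by linarith) (by linarith [abs_nonneg σ, abs_nonneg τ])))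
    (by
      push_cast
      rw [abs_neg]
      nlinarith [abs_nonneg σ, abs_nonneg τ])
    (by
      push_cast
      rw [abs_one]
      nlinarith [abs_nonneg σ, abs_nonneg τ])
  refine this.trans_eq ?_
  rw [← Real.norm_eq_abs, ← Complex.norm_real]
  congr 1
  push_cast
  ring

lemma isAlgebraic_exp_two_pi_I_mul_div_pi {δ : ℝ}
    (h : IsAlgebraic ℚ (Complex.exp (δ * Complex.I))) :
    IsAlgebraic ℚ (Complex.exp (2 * π * Complex.I * (δ / π : ℝ))) := by
  have : Complex.exp (2 * π * Complex.I * (δ / π : ℝ)) = Complex.exp (δ * Complex.I) ^ 2 := by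
    have hπ : (π : ℂ) ≠ 0 := by exact_mod_cast Real.pi_ne_zero
    rw [← Complex.exp_nat_mul]
    push_cast
    congr 1
    field_simp
  rw [this]
  exact h.pow 2

/-- **Corollary 2.** Let `δ₁, δ₂ ∈ [0, 2π)` be such that `e^{iδ₁}` and `e^{iδ₂}` are
algebraic. There exists an (explicit) constant `c₂ > 0`, depending only on `δ₁, δ₂`, such
that for every `n ∈ ℤ` with `δ₁ + nδ₂ ∉ ℤπ` one has
`|sin(δ₁ + nδ₂)| ≥ (|n| + 2)^{−c₂}`. -/
theorem sin_linear_combination_lower_bound (δ₁ δ₂ : ℝ)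
    (h₁ : δ₁ ∈ Set.Ico 0 (2 * π)) (h₂ : δ₂ ∈ Set.Ico 0 (2 * π))
    (halg₁ : IsAlgebraic ℚ (Complex.exp (δ₁ * Complex.I)))
    (halg₂ : IsAlgebraic ℚ (Complex.exp (δ₂ * Complex.I))) :
    ∃ c₂ : ℝ, 0 < c₂ ∧
      ∀ n : ℤ, (∀ m : ℤ, δ₁ + n * δ₂ ≠ m * π) →
        |Real.sin (δ₁ + n * δ₂)| ≥ ((|n| : ℤ) + 2 : ℝ) ^ (-c₂) := by
  obtain ⟨C, hC, h⟩ := exists_rpow_neg_le_abs_add_mul_sub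
    (isAlgebraic_exp_two_pi_I_mul_div_pi halg₂) (isAlgebraic_exp_two_pi_I_mul_div_pi halg₁)
  refine ⟨C, hC, fun n hn => ?_⟩
  have hπ := Real.pi_pos
  set x : ℝ := δ₁ / π + n * (δ₂ / π) with hx
  have hxπ : (x - round x) * π = δ₁ + n * δ₂ - round x * π := by
    rw [hx]
    field_simp
  have hround : |x - round x| ≤ 1 / 2 := abs_sub_round x
  have hlow := h n (round x) (by linarith) fun h0 => hn (round x) (by
    rw [h0, zero_mul] at hxπ
    linarith)
  rw [Int.cast_abs, ge_iff_le]
  refine hlow.trans ?_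
  have habs : |(x - round x) * π| = |x - round x| * π := by rw [abs_mul, abs_of_pos hπ]
  have hsin : |Real.sin ((x - round x) * π)| = |Real.sin (δ₁ + n * δ₂)| := by
    rw [hxπ, Real.sin_sub_int_mul_pi, abs_mul, abs_zpow, abs_neg, abs_one, one_zpow, one_mul]
  rw [← hsin]
  calc |x - round x| ≤ 2 * |x - round x| := by linarith [abs_nonneg (x - round x)]
    _ = 2 / π * |(x - round x) * π| := by rw [habs]; field_simp
    _ ≤ _ := Real.mul_abs_le_abs_sin (by rw [habs]; nlinarith)
end
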